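/- arXiv:0812.2460 — 4 statements merged into one kernel-verified Lean document; each statement's English description precedes it below -/
import Mathlib

section
/- Let n ≥ 1, T > 0 and M > 0. Let u : ℝⁿ × [0,T] → ℝ be a smooth positive solution of the heat equation ∂ₜu = Δu on ℝⁿ × [0,T] satisfying 0 < u ≤ M everywhere. Then for every x ∈ ℝⁿ and every t ∈ (0,T], one has ‖∇u(x,t)‖ / u(x,t) ≤ (1/√t) · √(log(M / u(x,t))). -/
open Set

/-- The Laplacian of `f : ℝⁿ → ℝ` (flat Euclidean metric): the trace of the
second derivative, i.e. the sum of the second partial derivatives. -/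
noncomputable def lap {n : ℕ} (f : EuclideanSpace ℝ (Fin n) → ℝ)
    (x : EuclideanSpace ℝ (Fin n)) : ℝ :=
  ∑ i : Fin n,
    fderiv ℝ (fun y => fderiv ℝ f y (EuclideanSpace.single i 1)) x
      (EuclideanSpace.single i 1)

section Laplacian

variable {n : ℕ} {f g : EuclideanSpace ℝ (Fin n) → ℝ}

lemma differentiable_fderiv_apply (hf : ContDiff ℝ 2 f) (e : EuclideanSpace ℝ (Fin n)) :
    Differentiable ℝ fun y => fderiv ℝ f y e :=
  ((hf.fderiv_right (m := 1) (by norm_num)).clm_apply contDiff_const).differentiable (by norm_num)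

lemma lap_sub (hf : ContDiff ℝ 2 f) (hg : ContDiff ℝ 2 g) (x : EuclideanSpace ℝ (Fin n)) :
    lap (fun y => f y - g y) x = lap f x - lap g x := by
  have hf' : Differentiable ℝ f := hf.differentiable (by norm_num)
  have hg' : Differentiable ℝ g := hg.differentiable (by norm_num)
  simp only [lap, ← Finset.sum_sub_distrib]
  refine Finset.sum_congr rfl fun i _ => ?_
  have h : (fun y => fderiv ℝ (fun z => f z - g z) y (EuclideanSpace.single i 1)) =
      fun y => fderiv ℝ f y (EuclideanSpace.single i 1) -
        fderiv ℝ g y (EuclideanSpace.single i 1) := by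
    funext y
    rw [fderiv_fun_sub (hf' y) (hg' y)]
    rfl
  rw [h, fderiv_fun_sub (differentiable_fderiv_apply hf _ x)
    (differentiable_fderiv_apply hg _ x)]
  rfl

lemma lap_mul (hf : ContDiff ℝ 2 f) (hg : ContDiff ℝ 2 g) (x : EuclideanSpace ℝ (Fin n)) :
    lap (fun y => f y * g y) x = f x * lap g x + g x * lap f x +
      2 * ∑ i : Fin n, fderiv ℝ f x (EuclideanSpace.single i 1) *
        fderiv ℝ g x (EuclideanSpace.single i 1) := by
  have hf' : Differentiable ℝ f := hf.differentiable (by norm_num)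
  have hg' : Differentiable ℝ g := hg.differentiable (by norm_num)
  simp only [lap, Finset.mul_sum, ← Finset.sum_add_distrib]
  refine Finset.sum_congr rfl fun i _ => ?_
  have h : (fun y => fderiv ℝ (fun z => f z * g z) y (EuclideanSpace.single i 1)) =
      fun y => f y * fderiv ℝ g y (EuclideanSpace.single i 1) +
        g y * fderiv ℝ f y (EuclideanSpace.single i 1) := by
    funext y
    rw [fderiv_fun_mul (hf' y) (hg' y)]
    rfl
  have hdf := differentiable_fderiv_apply hf (EuclideanSpace.single i 1)
  have hdg := differentiable_fderiv_apply hg (EuclideanSpace.single i 1)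
  rw [h, fderiv_fun_add ((hf' x).fun_mul (hdg x)) ((hg' x).fun_mul (hdf x)),
    fderiv_fun_mul (hf' x) (hdg x), fderiv_fun_mul (hg' x) (hdf x)]
  simp only [add_apply, smul_apply, smul_eq_mul]
  ring

lemma lap_const_mul (c : ℝ) (hf : ContDiff ℝ 2 f) (x : EuclideanSpace ℝ (Fin n)) :
    lap (fun y => c * f y) x = c * lap f x := by
  rw [lap_mul contDiff_const hf]
  simp [lap]

lemma lap_comp_add_right (a x : EuclideanSpace ℝ (Fin n)) :
    lap (fun y => f (y + a)) x = lap f (x + a) := by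
  simp only [lap, fderiv_comp_add_right]
  refine Finset.sum_congr rfl fun i _ => ?_
  rw [fderiv_comp_add_right (f := fun y => fderiv ℝ f y (EuclideanSpace.single i 1))]

lemma hasFDerivAt_exp_inner (w y x : EuclideanSpace ℝ (Fin n)) (c : ℝ) :
    HasFDerivAt (fun z => Real.exp (inner ℝ w (z - y) + c))
      (Real.exp (inner ℝ w (x - y) + c) • innerSL ℝ w) x := by
  have h : HasFDerivAt (fun z => inner ℝ w (z - y) + c) (innerSL ℝ w) x := by
    have := ((innerSL ℝ w).hasFDerivAt (x := x - y)).comp x ((hasFDerivAt_id x).sub_const y)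
    exact this.add_const c
  exact h.exp

lemma contDiff_exp_inner (w y : EuclideanSpace ℝ (Fin n)) (c : ℝ) :
    ContDiff ℝ 2 (fun z => Real.exp (inner ℝ w (z - y) + c)) :=
  (((contDiff_const (c := w)).inner ℝ (contDiff_id.sub contDiff_const)).add contDiff_const).exp

lemma lap_exp_inner (w y x : EuclideanSpace ℝ (Fin n)) (c : ℝ) :
    lap (fun z => Real.exp (inner ℝ w (z - y) + c)) x =
      ‖w‖ ^ 2 * Real.exp (inner ℝ w (x - y) + c) := by
  have h : ∀ z, fderiv ℝ (fun z => Real.exp (inner ℝ w (z - y) + c)) z =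
      Real.exp (inner ℝ w (z - y) + c) • innerSL ℝ w :=
    fun z => (hasFDerivAt_exp_inner w y z c).fderiv
  simp only [lap, h, EuclideanSpace.norm_sq_eq, Finset.sum_mul]
  refine Finset.sum_congr rfl fun i _ => ?_
  have h2 := (hasFDerivAt_exp_inner w y x c).mul_const (w i)
  have h3 : (fun z => (Real.exp (inner ℝ w (z - y) + c) • innerSL ℝ w)
      (EuclideanSpace.single i (1 : ℝ))) =
      fun z => Real.exp (inner ℝ w (z - y) + c) * w i := by
    funext z
    simp [EuclideanSpace.inner_single_right]
  rw [h3, h2.fderiv]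
  simp [EuclideanSpace.inner_single_right]
  ring

lemma lap_norm_sq (x : EuclideanSpace ℝ (Fin n)) :
    lap (fun z => ‖z‖ ^ 2) x = 2 * n := by
  have h : ∀ z : EuclideanSpace ℝ (Fin n), fderiv ℝ (fun z => ‖z‖ ^ 2) z = 2 • innerSL ℝ z :=
    fun z => (hasStrictFDerivAt_norm_sq z).hasFDerivAt.fderiv
  have h2 : ∀ i : Fin n, fderiv ℝ (fun z : EuclideanSpace ℝ (Fin n) =>
      (2 • innerSL ℝ z) (EuclideanSpace.single i (1 : ℝ))) x (EuclideanSpace.single i 1) = 2 := by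
    intro i
    have h3 : (fun z : EuclideanSpace ℝ (Fin n) =>
        (2 • innerSL ℝ z) (EuclideanSpace.single i (1 : ℝ))) =
        ((2 : ℝ) • EuclideanSpace.proj i : EuclideanSpace ℝ (Fin n) →L[ℝ] ℝ) := by
      funext z
      simp [EuclideanSpace.inner_single_right]
    rw [h3, ContinuousLinearMap.fderiv]
    simp
  simp only [lap, h, h2]
  simp [mul_comm]

lemma sum_fderiv_mul (w x : EuclideanSpace ℝ (Fin n)) :
    ∑ i : Fin n, w i * fderiv ℝ f x (EuclideanSpace.single i 1) = fderiv ℝ f x w := by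
  conv_rhs => rw [← (EuclideanSpace.basisFun (Fin n) ℝ).sum_repr w]
  simp

lemma deriv_deriv_nonpos_of_isLocalMax {φ : ℝ → ℝ} {a : ℝ} (h : IsLocalMax φ a)
    (hc : ContinuousAt φ a) : deriv (deriv φ) a ≤ 0 := by
  by_contra! hpos
  have hmin := isLocalMin_of_deriv_deriv_pos hpos h.deriv_eq_zero hc
  have heq : φ =ᶠ[nhds a] fun _ => φ a := by
    filter_upwards [h, hmin] with z h1 h2 using le_antisymm h1 h2
  have := heq.deriv.deriv_eq
  simp at this
  linarith

lemma lap_nonpos_of_isLocalMax {x : EuclideanSpace ℝ (Fin n)} (hf : ContDiff ℝ 2 f)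
    (h : IsLocalMax f x) : lap f x ≤ 0 := by
  refine Finset.sum_nonpos fun i _ => ?_
  set e : EuclideanSpace ℝ (Fin n) := EuclideanSpace.single i 1
  have hline : ∀ s : ℝ, HasDerivAt (fun s : ℝ => x + s • e) e s := by
    intro s
    simpa using ((hasDerivAt_id s).smul_const e).const_add x
  have h1 : deriv (fun s : ℝ => f (x + s • e)) = fun s => fderiv ℝ f (x + s • e) e := by
    funext s
    exact (((hf.differentiable (by norm_num)) _).hasFDerivAt.comp_hasDerivAt s (hline s)).deriv
  have h2 : deriv (fun s : ℝ => fderiv ℝ f (x + s • e) e) 0 =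
      fderiv ℝ (fun y => fderiv ℝ f y e) x e := by
    have := ((differentiable_fderiv_apply hf e (x + (0 : ℝ) • e)).hasFDerivAt.comp_hasDerivAt 0
      (hline 0)).deriv
    simpa [Function.comp_def] using this
  rw [← h2, ← h1]
  have hcont : Continuous fun s : ℝ => x + s • e := by fun_prop
  refine deriv_deriv_nonpos_of_isLocalMax ?_ (hf.continuous.comp hcont).continuousAt
  have ht : Filter.Tendsto (fun s : ℝ => x + s • e) (nhds 0) (nhds x) := by
    simpa using hcont.tendsto 0
  have := ht.eventually h
  simpa [IsLocalMax, IsMaxFilter] using this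

end Laplacian

/-- The weak maximum principle on the slab `ℝⁿ × [0,T]` for solutions of the heat equation which
are bounded above. -/
theorem heat_nonpos_of_bddAbove {n : ℕ} {T B : ℝ} {G : EuclideanSpace ℝ (Fin n) → ℝ → ℝ}
    (hcont : ContinuousOn (fun p : EuclideanSpace ℝ (Fin n) × ℝ => G p.1 p.2)
      (univ ×ˢ Icc 0 T))
    (hC2 : ∀ t ∈ Icc (0 : ℝ) T, ContDiff ℝ 2 fun x => G x t)
    (hheat : ∀ x, ∀ t ∈ Icc (0 : ℝ) T,
      HasDerivWithinAt (G x) (lap (fun y => G y t) x) (Icc 0 T) t)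
    (hB : ∀ x, ∀ t ∈ Icc (0 : ℝ) T, G x t ≤ B)
    (h0 : ∀ x, G x 0 ≤ 0) :
    ∀ x, ∀ t ∈ Icc (0 : ℝ) T, G x t ≤ 0 := by
  intro x₁ t₁ ht₁
  by_contra! hpos
  have hD : 0 < ‖x₁‖ ^ 2 + (2 * n + 1) * t₁ + 1 := by
    have := ht₁.1
    positivity
  obtain ⟨η, hη, hηlt⟩ : ∃ η > 0, η * (‖x₁‖ ^ 2 + (2 * n + 1) * t₁ + 1) = G x₁ t₁ :=
    ⟨G x₁ t₁ / (‖x₁‖ ^ 2 + (2 * n + 1) * t₁ + 1), div_pos hpos hD, by field_simp⟩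
  let H : EuclideanSpace ℝ (Fin n) → ℝ → ℝ :=
    fun x t => G x t - η * (‖x‖ ^ 2 + (2 * n + 1) * t)
  have hH1 : 0 < H x₁ t₁ := by
    simp only [H]
    nlinarith
  obtain ⟨R, hRx, hR0, hRB⟩ : ∃ R, ‖x₁‖ ≤ R ∧ 0 ≤ R ∧ B ≤ η * R ^ 2 := by
    refine ⟨max ‖x₁‖ √(|B| / η), le_max_left _ _, by positivity, ?_⟩
    have h1 : |B| / η ≤ max ‖x₁‖ √(|B| / η) ^ 2 := by
      calc |B| / η = √(|B| / η) ^ 2 := (Real.sq_sqrt (by positivity)).symm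
        _ ≤ _ := by gcongr; exact le_max_right _ _
    rw [div_le_iff₀ hη] at h1
    linarith [le_abs_self B]
  have hHcont : ContinuousOn (fun p : EuclideanSpace ℝ (Fin n) × ℝ => H p.1 p.2)
      (univ ×ˢ Icc 0 T) := by
    refine hcont.sub (Continuous.continuousOn ?_)
    fun_prop
  obtain ⟨⟨x₀, t₀⟩, ⟨-, ht₀⟩, hmax⟩ :=
    ((isCompact_closedBall (0 : EuclideanSpace ℝ (Fin n)) R).prod
      (isCompact_Icc (a := (0 : ℝ)) (b := T))).exists_isMaxOn
      ⟨(x₁, t₁), by simpa using hRx, ht₁⟩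
      (hHcont.mono (prod_mono (subset_univ _) subset_rfl))
  have hmax₁ : H x₁ t₁ ≤ H x₀ t₀ :=
    hmax (show (x₁, t₁) ∈ _ from ⟨by simpa using hRx, ht₁⟩)
  have hglob : ∀ x, ∀ t ∈ Icc (0 : ℝ) T, H x t ≤ H x₀ t₀ := by
    intro x t ht
    by_cases hx : ‖x‖ ≤ R
    · exact hmax (show (x, t) ∈ _ from ⟨by simpa using hx, ht⟩)
    · have h1 : R ^ 2 ≤ ‖x‖ ^ 2 := by
        push Not at hx
        gcongr
      have h2 : 0 ≤ (2 * n + 1) * t := by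
        have := ht.1
        positivity
      have h3 := hB x t ht
      have : H x t ≤ 0 := by
        simp only [H]
        nlinarith
      linarith
  have ht₀pos : 0 < t₀ := by
    refine lt_of_le_of_ne ht₀.1 fun h => ?_
    subst h
    have : H x₀ 0 ≤ 0 := by
      simp only [H]
      have := h0 x₀
      have : 0 ≤ η * (‖x₀‖ ^ 2 + (2 * n + 1) * 0) := by positivity
      linarith
    linarith
  have htime : HasDerivWithinAt (H x₀) (lap (fun y => G y t₀) x₀ - η * (2 * n + 1))
      (Icc 0 T) t₀ := by
    refine (hheat x₀ t₀ ht₀).sub (HasDerivAt.hasDerivWithinAt ?_)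
    simpa using (((hasDerivAt_id t₀).const_mul (2 * (n : ℝ) + 1)).const_add (‖x₀‖ ^ 2)).const_mul η
  have htime_nonneg : 0 ≤ lap (fun y => G y t₀) x₀ - η * (2 * n + 1) := by
    have hloc : IsLocalMaxOn (H x₀) (Icc 0 T) t₀ :=
      IsMaxOn.localize fun t ht => hglob x₀ t ht
    have hcone : (0 : ℝ) - t₀ ∈ posTangentConeAt (Icc 0 T) t₀ := by
      refine sub_mem_posTangentConeAt_of_segment_subset ?_
      exact (convex_Icc 0 T).segment_subset ht₀ ⟨le_rfl, ht₀.1.trans ht₀.2⟩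
    have := hloc.hasFDerivWithinAt_nonpos htime.hasFDerivWithinAt hcone
    simp at this
    nlinarith
  have hquad : ContDiff ℝ 2 fun x : EuclideanSpace ℝ (Fin n) => ‖x‖ ^ 2 := contDiff_norm_sq ℝ
  have hspace : lap (fun y => G y t₀ - η * ‖y‖ ^ 2) x₀ ≤ 0 := by
    refine lap_nonpos_of_isLocalMax ((hC2 t₀ ht₀).sub (contDiff_const.mul hquad)) ?_
    refine Filter.Eventually.of_forall fun x => ?_
    have := hglob x t₀ ht₀
    simp only [H] at this
    dsimp only
    linarith
  rw [lap_sub (hC2 t₀ ht₀) (contDiff_const.mul hquad), lap_const_mul _ hquad, lap_norm_sq]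
    at hspace
  linarith


/-- `G` is a classical solution of the heat equation on the slab `ℝⁿ × [0,T]`. -/
structure IsHeatSolution {n : ℕ} (T : ℝ) (G : EuclideanSpace ℝ (Fin n) → ℝ → ℝ) : Prop where
  continuousOn : ContinuousOn (fun p : EuclideanSpace ℝ (Fin n) × ℝ => G p.1 p.2)
    (univ ×ˢ Icc 0 T)
  contDiff : ∀ t ∈ Icc (0 : ℝ) T, ContDiff ℝ 2 fun x => G x t
  hasDerivWithinAt : ∀ x, ∀ t ∈ Icc (0 : ℝ) T,
    HasDerivWithinAt (G x) (lap (fun y => G y t) x) (Icc 0 T) t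

namespace IsHeatSolution

variable {n : ℕ} {T : ℝ} {G₁ G₂ : EuclideanSpace ℝ (Fin n) → ℝ → ℝ}

lemma sub (h₁ : IsHeatSolution T G₁) (h₂ : IsHeatSolution T G₂) :
    IsHeatSolution T fun x t => G₁ x t - G₂ x t where
  continuousOn := h₁.continuousOn.sub h₂.continuousOn
  contDiff t ht := (h₁.contDiff t ht).sub (h₂.contDiff t ht)
  hasDerivWithinAt x t ht := by
    rw [lap_sub (h₁.contDiff t ht) (h₂.contDiff t ht)]
    exact (h₁.hasDerivWithinAt x t ht).sub (h₂.hasDerivWithinAt x t ht)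

lemma const_mul (c : ℝ) (h₁ : IsHeatSolution T G₁) :
    IsHeatSolution T fun x t => c * G₁ x t where
  continuousOn := continuousOn_const.mul h₁.continuousOn
  contDiff t ht := contDiff_const.mul (h₁.contDiff t ht)
  hasDerivWithinAt x t ht := by
    rw [lap_const_mul c (h₁.contDiff t ht)]
    exact (h₁.hasDerivWithinAt x t ht).const_mul c

lemma exp_inner (T : ℝ) (w y : EuclideanSpace ℝ (Fin n)) :
    IsHeatSolution T fun x t => Real.exp (inner ℝ w (x - y) + ‖w‖ ^ 2 * t) where
  continuousOn := Continuous.continuousOn (by fun_prop)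
  contDiff t _ := contDiff_exp_inner w y _
  hasDerivWithinAt x t _ := by
    rw [lap_exp_inner]
    have := (((hasDerivAt_id t).const_mul (‖w‖ ^ 2)).const_add (inner ℝ w (x - y))).exp
    simpa [mul_comm] using this.hasDerivWithinAt

/-- Invariance of the heat equation under Galilean boosts. -/
lemma galilean_boost {u : EuclideanSpace ℝ (Fin n) → ℝ → ℝ} (hT : 0 < T)
    (hsmooth : ContDiffOn ℝ (⊤ : ℕ∞)
      (fun p : EuclideanSpace ℝ (Fin n) × ℝ => u p.1 p.2) (univ ×ˢ Icc 0 T))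
    (hheat : ∀ x, ∀ t ∈ Icc (0 : ℝ) T,
      derivWithin (fun s => u x s) (Icc 0 T) t = lap (fun y => u y t) x)
    (w y : EuclideanSpace ℝ (Fin n)) :
    IsHeatSolution T fun x t =>
      Real.exp (inner ℝ w (x - y) + ‖w‖ ^ 2 * t) * u (x + (2 * t) • w) t := by
  have hslice : ∀ t ∈ Icc (0 : ℝ) T, ContDiff ℝ 2 fun x => u x t := by
    intro t ht
    have h1 : ContDiff ℝ 2 fun x : EuclideanSpace ℝ (Fin n) => (x, t) := by fun_prop
    exact (hsmooth.of_le (WithTop.coe_le_coe.2 le_top)).comp_contDiff h1 fun x => ⟨mem_univ _, ht⟩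
  have hshift : ∀ t ∈ Icc (0 : ℝ) T, ContDiff ℝ 2 fun x => u (x + (2 * t) • w) t := by
    intro t ht
    exact (hslice t ht).comp (contDiff_id.add contDiff_const)
  refine ⟨?_, fun t ht => (contDiff_exp_inner w y _).mul (hshift t ht), fun x t ht => ?_⟩
  · refine ContinuousOn.mul (Continuous.continuousOn (by fun_prop)) ?_
    have hγ : Continuous fun p : EuclideanSpace ℝ (Fin n) × ℝ => (p.1 + (2 * p.2) • w, p.2) := by
      fun_prop
    exact hsmooth.continuousOn.comp hγ.continuousOn fun p hp => ⟨mem_univ _, hp.2⟩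
  set z := x + (2 * t) • w with hz
  obtain ⟨F', hF'⟩ := hsmooth.differentiableOn (by simp) (z, t) ⟨mem_univ _, ht⟩
  have hmaps : ∀ γ : ℝ → EuclideanSpace ℝ (Fin n),
      MapsTo (fun s => (γ s, s)) (Icc 0 T) (univ ×ˢ Icc 0 T) := fun γ s hs => ⟨mem_univ _, hs⟩
  have hFt : F' (0, 1) = lap (fun y => u y t) z := by
    rw [← hheat z t ht]
    have hγ : HasDerivWithinAt (fun s : ℝ => (z, s)) ((0 : EuclideanSpace ℝ (Fin n)), (1 : ℝ))
        (Icc 0 T) t := (hasDerivWithinAt_const _ _ _).prodMk (hasDerivWithinAt_id _ _)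
    exact ((hF'.comp_hasDerivWithinAt t hγ (hmaps _)).derivWithin
      (uniqueDiffOn_Icc hT t ht)).symm
  have hFx : ∀ v, F' (v, 0) = fderiv ℝ (fun y => u y t) z v := by
    intro v
    have hγ : HasFDerivAt (fun x : EuclideanSpace ℝ (Fin n) => (x, t))
        ((ContinuousLinearMap.id ℝ _).prod 0) z := (hasFDerivAt_id z).prodMk (hasFDerivAt_const t z)
    have h := HasFDerivWithinAt.comp z hF' (hγ.hasFDerivWithinAt (s := univ))
      (show MapsTo (fun x => (x, t)) univ (univ ×ˢ Icc 0 T) from fun _ _ => ⟨mem_univ _, ht⟩)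
    rw [hasFDerivWithinAt_univ] at h
    have h' : fderiv ℝ (fun y => u y t) z = _ := h.fderiv
    rw [h']
    simp
  have hcurve : HasDerivWithinAt (fun s => u (x + (2 * s) • w) s)
      (2 * fderiv ℝ (fun y => u y t) z w + lap (fun y => u y t) z) (Icc 0 T) t := by
    have hγ : HasDerivWithinAt (fun s : ℝ => (x + (2 * s) • w, s)) ((2 : ℝ) • w, (1 : ℝ))
        (Icc 0 T) t := by
      refine HasDerivWithinAt.prodMk ?_ (hasDerivWithinAt_id _ _)
      simpa using ((((hasDerivAt_id t).const_mul (2 : ℝ)).smul_const w).const_add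
        x).hasDerivWithinAt
    have h := HasFDerivWithinAt.comp_hasDerivWithinAt (f := fun s : ℝ => (x + (2 * s) • w, s)) t
      hF' hγ (hmaps _)
    have hsplit : (((2 : ℝ) • w, (1 : ℝ)) : EuclideanSpace ℝ (Fin n) × ℝ) =
        (2 : ℝ) • (w, 0) + (0, 1) := by simp
    rw [hsplit, map_add, map_smul, hFx, hFt, smul_eq_mul] at h
    exact h
  have hexp := (exp_inner T w y).hasDerivWithinAt x t ht
  rw [lap_exp_inner] at hexp
  refine (hexp.mul hcurve).congr_deriv ?_
  rw [lap_mul (contDiff_exp_inner w y _) (hshift t ht), lap_exp_inner,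
    lap_comp_add_right (f := fun y => u y t), ← sum_fderiv_mul]
  simp only [(hasFDerivAt_exp_inner w y x _).fderiv, Finset.mul_sum,
    fderiv_comp_add_right (f := fun y => u y t), ← hz]
  simp only [smul_apply, innerSL_apply_apply,
    EuclideanSpace.inner_single_right, smul_eq_mul]
  have : ∀ i : Fin n, 2 * (Real.exp (inner ℝ w (x - y) + ‖w‖ ^ 2 * t) *
      (1 * (starRingEnd ℝ) (w i)) * fderiv ℝ (fun y => u y t) z (EuclideanSpace.single i 1)) =
      Real.exp (inner ℝ w (x - y) + ‖w‖ ^ 2 * t) *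
        (2 * (w i * fderiv ℝ (fun y => u y t) z (EuclideanSpace.single i 1))) := by
    intro i
    simp
    ring
  simp only [this, ← Finset.mul_sum]
  ring

end IsHeatSolution

lemma exp_mul_le_tangent {δ : ℝ} (hδ : δ ∈ Icc (0 : ℝ) 1) (σ b : ℝ) :
    Real.exp (δ * b) ≤
      (1 - δ) * Real.exp (δ * σ) + δ * Real.exp ((δ - 1) * σ) * Real.exp b := by
  have h := convexOn_exp.2 (mem_univ (0 : ℝ)) (mem_univ (b - σ)) (sub_nonneg.2 hδ.2) hδ.1
    (by ring)
  simp only [smul_eq_mul, mul_zero, zero_add, Real.exp_zero, mul_one] at h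
  have h2 := mul_le_mul_of_nonneg_left h (Real.exp_pos (δ * σ)).le
  rw [← Real.exp_add] at h2
  have h3 : Real.exp ((δ - 1) * σ) * Real.exp b = Real.exp (δ * σ) * Real.exp (b - σ) := by
    rw [← Real.exp_add, ← Real.exp_add]
    ring_nf
  calc Real.exp (δ * b) = Real.exp (δ * σ + δ * (b - σ)) := by ring_nf
    _ ≤ _ := h2
    _ = _ := by rw [mul_assoc, h3]; ring

lemma exists_mul_exp_sub_le {δ A c : ℝ} (hδ : δ ∈ Ioo (0 : ℝ) 1) (hA : 0 < A) (hc : 0 < c) :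
    ∃ B, ∀ b, A * Real.exp (δ * b) - c * Real.exp b ≤ B := by
  have h1δ : 0 < 1 - δ := sub_pos.2 hδ.2
  set σ := Real.log (A / c) / (1 - δ) with hσ
  refine ⟨A * ((1 - δ) * Real.exp (δ * σ)), fun b => ?_⟩
  have h := exp_mul_le_tangent ⟨hδ.1.le, hδ.2.le⟩ σ b
  have hs : A * Real.exp ((δ - 1) * σ) = c := by
    have : (δ - 1) * σ = -Real.log (A / c) := by
      rw [hσ]
      field_simp
      ring
    rw [this, Real.exp_neg, Real.exp_log (div_pos hA hc)]
    field_simp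
  have h2 := mul_le_mul_of_nonneg_left h hA.le
  have h3 : δ * (c * Real.exp b) ≤ c * Real.exp b :=
    mul_le_of_le_one_left (by positivity) hδ.2.le
  rw [← hs] at h3 ⊢
  nlinarith

/-- A Harnack inequality for bounded positive solutions of the heat equation, comparing the values
of the solution at two points at the same time. -/
theorem heat_harnack {n : ℕ} {T M : ℝ} (hT : 0 < T) (hM : 0 < M)
    {u : EuclideanSpace ℝ (Fin n) → ℝ → ℝ}
    (hsmooth : ContDiffOn ℝ (⊤ : ℕ∞)
      (fun p : EuclideanSpace ℝ (Fin n) × ℝ => u p.1 p.2) (univ ×ˢ Icc 0 T))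
    (hpos : ∀ x, ∀ t ∈ Icc (0 : ℝ) T, 0 < u x t)
    (hbound : ∀ x, ∀ t ∈ Icc (0 : ℝ) T, u x t ≤ M)
    (hheat : ∀ x, ∀ t ∈ Icc (0 : ℝ) T,
      derivWithin (fun s => u x s) (Icc 0 T) t = lap (fun y => u y t) x)
    {δ : ℝ} (hδ : δ ∈ Ioo (0 : ℝ) 1) (σ : ℝ) (v y : EuclideanSpace ℝ (Fin n))
    {t : ℝ} (ht : t ∈ Icc (0 : ℝ) T) :
    Real.exp (δ ^ 2 * ‖v‖ ^ 2 * t) * u (y + (2 * t * δ) • v) t ≤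
      (1 - δ) * Real.exp (δ * σ) * u y t +
        M * δ * Real.exp ((δ - 1) * σ) * Real.exp (‖v‖ ^ 2 * t) := by
  have hδ0 := hδ.1
  have hδ1 : 0 < 1 - δ := sub_pos.2 hδ.2
  have hu : IsHeatSolution T u := by
    simpa using IsHeatSolution.galilean_boost hT hsmooth hheat 0 y
  have hG := ((IsHeatSolution.galilean_boost hT hsmooth hheat (δ • v) y).sub
    (hu.const_mul ((1 - δ) * Real.exp (δ * σ)))).sub
    ((IsHeatSolution.exp_inner T v y).const_mul (M * δ * Real.exp ((δ - 1) * σ)))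
  have hnorm : ‖δ • v‖ ^ 2 = δ ^ 2 * ‖v‖ ^ 2 := by
    rw [norm_smul, mul_pow, Real.norm_eq_abs, sq_abs]
  obtain ⟨B, hB⟩ := exists_mul_exp_sub_le hδ
    (show 0 < M * Real.exp (‖δ • v‖ ^ 2 * T) by positivity)
    (show 0 < M * δ * Real.exp ((δ - 1) * σ) by positivity)
  have key := heat_nonpos_of_bddAbove (B := B) hG.continuousOn hG.contDiff hG.hasDerivWithinAt
    ?_ ?_ y t ht
  · simp only [sub_self, inner_zero_right, zero_add, hnorm, smul_smul] at key
    linarith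
  · intro x s hs
    refine le_trans ?_ (hB (inner ℝ v (x - y)))
    have h1 : Real.exp (inner ℝ (δ • v) (x - y) + ‖δ • v‖ ^ 2 * s) * u (x + (2 * s) • δ • v) s ≤
        M * Real.exp (‖δ • v‖ ^ 2 * T) * Real.exp (δ * inner ℝ v (x - y)) := by
      rw [real_inner_smul_left, Real.exp_add]
      calc _ ≤ Real.exp (δ * inner ℝ v (x - y)) * Real.exp (‖δ • v‖ ^ 2 * T) * M := by
            have := (hpos (x + (2 * s) • δ • v) s hs).le
            gcongr
            · exact hs.2
            · exact hbound _ s hs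
        _ = _ := by ring
    have h2 : 0 ≤ (1 - δ) * Real.exp (δ * σ) * u x s := by
      have := hpos x s hs
      positivity
    have h3 : M * δ * Real.exp ((δ - 1) * σ) * Real.exp (inner ℝ v (x - y)) ≤
        M * δ * Real.exp ((δ - 1) * σ) * Real.exp (inner ℝ v (x - y) + ‖v‖ ^ 2 * s) := by
      have : 0 ≤ ‖v‖ ^ 2 * s := mul_nonneg (by positivity) hs.1
      gcongr
      linarith
    linarith
  · intro x
    have h0 : (0 : ℝ) ∈ Icc (0 : ℝ) T := ⟨le_rfl, hT.le⟩
    simp only [mul_zero, add_zero, zero_smul, real_inner_smul_left]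
    have h1 := mul_le_mul_of_nonneg_right
      (exp_mul_le_tangent ⟨hδ.1.le, hδ.2.le⟩ σ (inner ℝ v (x - y))) (hpos x 0 h0).le
    have h2 := mul_le_mul_of_nonneg_left (hbound x 0 h0)
      (show 0 ≤ δ * Real.exp ((δ - 1) * σ) * Real.exp (inner ℝ v (x - y)) by positivity)
    linarith

/-- The infinitesimal form of the Harnack inequality. -/
theorem heat_fderiv_le {n : ℕ} {T M : ℝ} (hT : 0 < T) (hM : 0 < M)
    {u : EuclideanSpace ℝ (Fin n) → ℝ → ℝ}
    (hsmooth : ContDiffOn ℝ (⊤ : ℕ∞)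
      (fun p : EuclideanSpace ℝ (Fin n) × ℝ => u p.1 p.2) (univ ×ˢ Icc 0 T))
    (hpos : ∀ x, ∀ t ∈ Icc (0 : ℝ) T, 0 < u x t)
    (hbound : ∀ x, ∀ t ∈ Icc (0 : ℝ) T, u x t ≤ M)
    (hheat : ∀ x, ∀ t ∈ Icc (0 : ℝ) T,
      derivWithin (fun s => u x s) (Icc 0 T) t = lap (fun y => u y t) x)
    (v y : EuclideanSpace ℝ (Fin n)) {t : ℝ} (ht : t ∈ Icc (0 : ℝ) T) :
    2 * t * fderiv ℝ (fun z => u z t) y v ≤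
      u y t * (Real.log (M / u y t) + t * ‖v‖ ^ 2) := by
  have hu0 := hpos y t ht
  have hu : IsHeatSolution T u := by
    simpa using IsHeatSolution.galilean_boost hT hsmooth hheat 0 y
  set σ := Real.log (M / u y t) + ‖v‖ ^ 2 * t with hσ
  have hMσ : M * Real.exp (-σ) * Real.exp (‖v‖ ^ 2 * t) = u y t := by
    rw [mul_assoc, ← Real.exp_add, hσ]
    rw [show -(Real.log (M / u y t) + ‖v‖ ^ 2 * t) + ‖v‖ ^ 2 * t = -Real.log (M / u y t) by ring,
      Real.exp_neg, Real.exp_log (div_pos hM hu0)]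
    field_simp
  let φ : ℝ → ℝ := fun δ =>
    (1 - δ) * Real.exp (δ * σ) * u y t +
        M * δ * Real.exp ((δ - 1) * σ) * Real.exp (‖v‖ ^ 2 * t) -
      Real.exp (δ ^ 2 * ‖v‖ ^ 2 * t) * u (y + (2 * t * δ) • v) t
  have hφ0 : φ 0 = 0 := by simp [φ]
  have hφ : ∀ δ ∈ Icc (0 : ℝ) (1 / 2), φ 0 ≤ φ δ := by
    intro δ hδ
    rcases hδ.1.eq_or_lt with h | h
    · rw [h]
    · rw [hφ0]
      exact sub_nonneg.2 (heat_harnack hT hM hsmooth hpos hbound hheat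
        ⟨h, by linarith [hδ.2]⟩ σ v y ht)
  have hdiff : HasFDerivAt (fun z => u z t) (fderiv ℝ (fun z => u z t) y) (y + (2 * t * 0) • v) := by
    simpa using ((hu.contDiff t ht).differentiable (by norm_num) y).hasFDerivAt
  have hline : HasDerivAt (fun δ : ℝ => y + (2 * t * δ) • v) ((2 * t) • v) 0 := by
    simpa using (((hasDerivAt_id (0 : ℝ)).const_mul (2 * t)).smul_const v).const_add y
  have hd1 := hdiff.comp_hasDerivAt (0 : ℝ) hline
  have hid := hasDerivAt_id (0 : ℝ)
  have hd2 := (((hid.const_sub 1).mul (hid.mul_const σ).exp).mul_const (u y t)).add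
    (((hid.const_mul M).mul ((hid.sub_const 1).mul_const σ).exp).mul_const
      (Real.exp (‖v‖ ^ 2 * t)))
  have hd3 := (((hid.pow 2).mul_const (‖v‖ ^ 2)).mul_const t).exp.mul hd1
  have hφ' : HasDerivAt φ (-u y t + σ * u y t + M * Real.exp (-σ) * Real.exp (‖v‖ ^ 2 * t) -
      2 * t * fderiv ℝ (fun z => u z t) y v) 0 := by
    refine (hd2.sub hd3).congr_deriv ?_
    simp
    ring
  have hmin : IsLocalMinOn φ (Icc 0 (1 / 2)) 0 := IsMinOn.localize hφ
  have hcone : (1 / 2 : ℝ) - 0 ∈ posTangentConeAt (Icc (0 : ℝ) (1 / 2)) 0 := by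
    refine sub_mem_posTangentConeAt_of_segment_subset ?_
    exact (convex_Icc _ _).segment_subset (by norm_num) (by norm_num)
  have h := hmin.hasFDerivWithinAt_nonneg hφ'.hasDerivWithinAt.hasFDerivWithinAt hcone
  rw [hMσ] at h
  simp at h
  rw [hσ] at h
  linarith

/-- Hamilton's gradient estimate for positive bounded solutions of the heat
equation on ℝⁿ × [0,T]:
`‖∇u(x,t)‖ / u(x,t) ≤ (1/√t) · √(log(M / u(x,t)))` for `t ∈ (0,T]`. -/
theorem hamilton_gradient_estimate
    (n : ℕ) (hn : 1 ≤ n) (T M : ℝ) (hT : 0 < T) (hM : 0 < M)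
    (u : EuclideanSpace ℝ (Fin n) → ℝ → ℝ)
    (hsmooth : ContDiffOn ℝ (⊤ : ℕ∞)
      (fun p : EuclideanSpace ℝ (Fin n) × ℝ => u p.1 p.2) (univ ×ˢ Icc 0 T))
    (hpos : ∀ x, ∀ t ∈ Icc (0 : ℝ) T, 0 < u x t)
    (hbound : ∀ x, ∀ t ∈ Icc (0 : ℝ) T, u x t ≤ M)
    (hheat : ∀ x, ∀ t ∈ Icc (0 : ℝ) T,
      derivWithin (fun s => u x s) (Icc 0 T) t = lap (fun y => u y t) x) :
    ∀ x, ∀ t ∈ Ioc (0 : ℝ) T,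
      ‖gradient (fun y => u y t) x‖ / u x t
        ≤ (1 / Real.sqrt t) * Real.sqrt (Real.log (M / u x t)) := by
  intro x t ht
  have ht' : t ∈ Icc (0 : ℝ) T := ⟨ht.1.le, ht.2⟩
  have ht0 := ht.1
  have hu0 := hpos x t ht'
  set p := gradient (fun y => u y t) x with hp
  have hfd : ∀ v, fderiv ℝ (fun y => u y t) x v = inner ℝ p v := fun v => by
    rw [hp, gradient, InnerProductSpace.toDual_symm_apply]
  have h := heat_fderiv_le hT hM hsmooth hpos hbound hheat ((u x t)⁻¹ • p) x ht'
  rw [hfd, real_inner_smul_right, real_inner_self_eq_norm_sq, norm_smul, norm_inv,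
    Real.norm_of_nonneg hu0.le] at h
  have hsq : t * (‖p‖ / u x t) ^ 2 ≤ Real.log (M / u x t) := by
    refine le_of_mul_le_mul_left ?_ hu0
    have h1 : 2 * t * ((u x t)⁻¹ * ‖p‖ ^ 2) = u x t * (2 * (t * (‖p‖ / u x t) ^ 2)) := by
      field_simp
    have h2 : (u x t)⁻¹ * ‖p‖ = ‖p‖ / u x t := by ring
    rw [h1, h2] at h
    linarith
  rw [one_div_mul_eq_div, ← Real.sqrt_div' _ ht0.le]
  refine Real.le_sqrt_of_sq_le ?_
  rw [le_div_iff₀ ht0]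
  linarith
end

section
/- Let n ≥ 1, T > 0 and M > 0. Let u : ℝⁿ × [0,T] → ℝ be a smooth positive solution of the heat equation ∂ₜu = Δu on ℝⁿ × [0,T] satisfying 0 < u ≤ M everywhere. Then for every x, y ∈ ℝⁿ and every t ∈ (0,T], one has √(log(M / u(x,t))) ≤ √(log(M / u(y,t))) + ‖x − y‖ / √t. -/
open Set

theorem nonpos_of_isLocalMax_of_hasDerivAt {g g' : ℝ → ℝ} {a c : ℝ}
    (hmax : IsLocalMax g a) (hg : ∀ s, HasDerivAt g (g' s) s) (hg' : HasDerivAt g' c a) :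
    c ≤ 0 := by
  by_contra! hc
  have hd : deriv g = g' := funext fun s => (hg s).deriv
  have hmin : IsLocalMin g a :=
    isLocalMin_of_deriv_deriv_pos (by rw [hd, hg'.deriv]; exact hc)
      (hmax.deriv_eq_zero) (hg a).continuousAt
  have hconst : g =ᶠ[nhds a] fun _ => g a := by
    filter_upwards [hmax, hmin] with s h₁ h₂ using le_antisymm h₁ h₂
  have h0 : g' =ᶠ[nhds a] fun _ => 0 := by
    rw [← hd]
    simpa using hconst.deriv
  have : c = 0 := by
    rw [← hg'.deriv, h0.deriv_eq, deriv_const]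
  exact hc.ne' this

theorem nonneg_of_hasDerivWithinAt_of_le {g : ℝ → ℝ} {T t c : ℝ} (ht : t ∈ Ioc 0 T)
    (hg : HasDerivWithinAt g c (Icc 0 T) t) (hmax : ∀ s ∈ Ioc 0 T, g s ≤ g t) : 0 ≤ c := by
  have hg' := hg.mono (t := Icc 0 T) (s := Ioo 0 t)
    fun s hs => ⟨hs.1.le, hs.2.le.trans ht.2⟩
  rw [hasDerivWithinAt_iff_tendsto_slope' (by simp)] at hg'
  have := right_nhdsWithin_Ioo_neBot ht.1
  refine ge_of_tendsto hg' ?_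
  filter_upwards [self_mem_nhdsWithin] with s hs
  rw [slope_def_field]
  exact div_nonneg_of_nonpos (by linarith [hmax s ⟨hs.1, hs.2.le.trans ht.2⟩])
    (by linarith [hs.2])

section Line

variable {E : Type*} [NormedAddCommGroup E] [NormedSpace ℝ E]

theorem hasDerivAt_comp_line {f : E → ℝ} (hf : Differentiable ℝ f) (x e : E) (s : ℝ) :
    HasDerivAt (fun r : ℝ => f (x + r • e)) (fderiv ℝ f (x + s • e) e) s := by
  have h : HasDerivAt (fun r : ℝ => x + r • e) e s := by
    simpa using ((hasDerivAt_id s).smul_const e).const_add x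
  exact (hf (x + s • e)).hasFDerivAt.comp_hasDerivAt s h

theorem hasDerivAt_log_comp_line {f : E → ℝ} (hf : Differentiable ℝ f) (hpos : ∀ x, 0 < f x)
    (x e : E) (s : ℝ) :
    HasDerivAt (fun r : ℝ => Real.log (f (x + r • e)))
      (fderiv ℝ f (x + s • e) e / f (x + s • e)) s :=
  (hasDerivAt_comp_line hf x e s).log (hpos _).ne'

theorem hasDerivAt_deriv_log_comp_line {f : E → ℝ} (hf : ContDiff ℝ 2 f)
    (hpos : ∀ x, 0 < f x) (x e : E) :
    HasDerivAt (fun r : ℝ => fderiv ℝ f (x + r • e) e / f (x + r • e))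
      (fderiv ℝ (fun y => fderiv ℝ f y e) x e / f x - (fderiv ℝ f x e / f x) ^ 2) 0 := by
  have hf1 : Differentiable ℝ f := hf.differentiable (by norm_num)
  have hf2 : Differentiable ℝ fun y => fderiv ℝ f y e :=
    ((hf.fderiv_right (m := 1) (by norm_num)).clm_apply contDiff_const).differentiable
      (by norm_num)
  have h := (hasDerivAt_comp_line hf2 x e 0).div (hasDerivAt_comp_line hf1 x e 0)
    (hpos _).ne'
  refine h.congr_deriv ?_
  have := (hpos x).ne'
  simp only [zero_smul, add_zero]
  field_simp

end Line

theorem norm_add_smul_single_sq {n : ℕ} (x : EuclideanSpace ℝ (Fin n)) (i : Fin n) (s : ℝ) :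
    ‖x + s • EuclideanSpace.single i (1 : ℝ)‖ ^ 2 = ‖x‖ ^ 2 + 2 * s * x i + s ^ 2 := by
  rw [norm_add_sq_real, inner_smul_right, norm_smul]
  simp [EuclideanSpace.inner_single_right]
  ring

theorem two_point_first_order_le {s q z : ℝ} (hs : 0 < s) :
    -q ^ 2 + (q - z) ^ 2 / (1 + s) + s / (4 * (1 + s)) * q ^ 2 ≤ (1 + 4 / (3 * s)) * z ^ 2 := by
  have h : (1 + 4 / (3 * s)) * z ^ 2
      - (-q ^ 2 + (q - z) ^ 2 / (1 + s) + s / (4 * (1 + s)) * q ^ 2)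
      = ((3 * s * q + 4 * z) ^ 2 / (12 * s) + s * (1 + 4 / (3 * s)) * z ^ 2) / (1 + s) := by
    field_simp
    ring
  have : 0 ≤ ((3 * s * q + 4 * z) ^ 2 / (12 * s) + s * (1 + 4 / (3 * s)) * z ^ 2) / (1 + s) := by
    positivity
  linarith

theorem sqrt_le_sqrt_add_of_forall {a b d : ℝ} (ha : 0 ≤ a) (hd : 0 ≤ d)
    (h : ∀ s, 0 < s → b ≤ (1 + s) * a + (1 + s) / s * d ^ 2) :
    Real.sqrt b ≤ Real.sqrt a + d := by
  refine le_of_forall_pos_le_add fun η hη => ?_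
  have hα := Real.sqrt_nonneg a
  have hsq := Real.sq_sqrt ha
  set α := Real.sqrt a
  have h1 := h ((d + η / 2) / (α + η / 2)) (by positivity)
  refine Real.sqrt_le_iff.2 ⟨by positivity, h1.trans ?_⟩
  have e : (1 + (d + η / 2) / (α + η / 2)) * (α + η / 2) ^ 2
      + (1 + (d + η / 2) / (α + η / 2)) / ((d + η / 2) / (α + η / 2)) * (d + η / 2) ^ 2
      = (α + d + η) ^ 2 := by
    field_simp
    ring
  rw [← e, ← hsq]
  gcongr <;> linarith

/-- The two-point function whose maximum is controlled by the parabolic maximum principle. -/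
noncomputable def twoPoint {n : ℕ} (v : EuclideanSpace ℝ (Fin n) → ℝ → ℝ) (s δ K : ℝ)
    (x y : EuclideanSpace ℝ (Fin n)) (t : ℝ) : ℝ :=
  (1 + s) * Real.log (v x t) - Real.log (v y t) - (1 + s) / s * (‖x - y‖ ^ 2 / t)
    - δ * ‖x‖ ^ 2 - δ * K * t

theorem le_of_twoPoint_isMax {n : ℕ} {T s δ K t : ℝ}
    {v : EuclideanSpace ℝ (Fin n) → ℝ → ℝ} (hs : 0 < s) (hδ : 0 < δ)
    (hcd : ∀ t ∈ Icc 0 T, ContDiff ℝ 2 fun x => v x t)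
    (hpos : ∀ x, ∀ t ∈ Icc 0 T, 0 < v x t)
    (hheat : ∀ x, ∀ t ∈ Icc 0 T,
      HasDerivWithinAt (fun r => v x r) (lap (fun y => v y t) x) (Icc 0 T) t)
    (ht : t ∈ Ioc 0 T) (x y : EuclideanSpace ℝ (Fin n))
    (hmax : ∀ x' y', ∀ t' ∈ Ioc 0 T, twoPoint v s δ K x' y' t' ≤ twoPoint v s δ K x y t) :
    K ≤ 2 * n + 4 * (1 + 4 / (3 * s)) * (δ * ‖x‖ ^ 2) := by
  have htI : t ∈ Icc 0 T := ⟨ht.1.le, ht.2⟩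
  have ht0 := ht.1
  set f : EuclideanSpace ℝ (Fin n) → ℝ := fun x => v x t with hf
  have hf2 : ContDiff ℝ 2 f := hcd t htI
  have hf1 : Differentiable ℝ f := hf2.differentiable (by norm_num)
  have hfpos : ∀ x, 0 < f x := fun x => hpos x t htI
  let e : Fin n → EuclideanSpace ℝ (Fin n) := fun i => EuclideanSpace.single i 1
  let D : Fin n → EuclideanSpace ℝ (Fin n) → ℝ := fun i x => fderiv ℝ f x (e i) / f x
  let H : Fin n → EuclideanSpace ℝ (Fin n) → ℝ :=
    fun i x => fderiv ℝ (fun y => fderiv ℝ f y (e i)) x (e i) / f x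
  let q : Fin n → ℝ := fun i => 2 * ((1 + s) / s) * ((y i - x i) / t)
  have hlapf : ∀ z, lap f z / f z = ∑ i, H i z := fun z => by
    simp only [lap, Finset.sum_div, H, e]
  have hquad : ∀ (z : EuclideanSpace ℝ (Fin n)) (i : Fin n) (r : ℝ),
      HasDerivAt (fun r : ℝ => ‖z + r • e i‖ ^ 2) (2 * z i + 2 * r) r := fun z i r => by
    simp only [e, norm_add_smul_single_sq]
    have := (((hasDerivAt_id r).const_mul 2).mul_const (z i)).const_add (‖z‖ ^ 2) |>.add
      ((hasDerivAt_id r).pow 2)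
    refine (this.congr_deriv ?_)
    simp
  have hline := fun z i => hasDerivAt_log_comp_line hf1 hfpos z (e i)
  -- first-order condition in `y`
  have hDy : ∀ i, D i y = -q i := fun i => by
    have hm : IsLocalMax (fun r : ℝ => twoPoint v s δ K x (y + r • e i) t) 0 :=
      Filter.Eventually.of_forall fun r => by simpa using hmax x (y + r • e i) t ht
    have h1 := hquad (y - x) i 0
    have hd : HasDerivAt (fun r : ℝ => twoPoint v s δ K x (y + r • e i) t)
        (- D i y - (1 + s) / s * ((2 * (y - x) i + 2 * 0) / t)) 0 := by
      have := ((((hline y i 0).const_sub ((1 + s) * Real.log (f x))).sub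
        ((h1.div_const t).const_mul ((1 + s) / s))).sub_const (δ * ‖x‖ ^ 2)).sub_const
          (δ * K * t)
      refine (this.congr_deriv (by simp [D])).congr_of_eventuallyEq
        (Filter.Eventually.of_forall fun r => ?_)
      simp only [twoPoint, hf, Pi.sub_apply]
      rw [norm_sub_rev x, add_sub_right_comm]
    have := hm.hasDerivAt_eq_zero hd
    simp only [PiLp.sub_apply] at this
    simp only [q]
    linear_combination -this
  -- first-order condition in `x`
  have hDx : ∀ i, (1 + s) * D i x = -q i + 2 * δ * x i := fun i => by
    have hm : IsLocalMax (fun r : ℝ => twoPoint v s δ K (x + r • e i) y t) 0 :=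
      Filter.Eventually.of_forall fun r => by simpa using hmax (x + r • e i) y t ht
    have h1 := hquad (x - y) i 0
    have h2 := hquad x i 0
    have hd : HasDerivAt (fun r : ℝ => twoPoint v s δ K (x + r • e i) y t)
        ((1 + s) * D i x - (1 + s) / s * ((2 * (x - y) i + 2 * 0) / t)
          - δ * (2 * x i + 2 * 0)) 0 := by
      have := ((((hline x i 0).const_mul (1 + s)).sub_const (Real.log (f y))).sub
        ((h1.div_const t).const_mul ((1 + s) / s))).sub (h2.const_mul δ) |>.sub_const
          (δ * K * t)
      refine (this.congr_deriv (by simp [D])).congr_of_eventuallyEq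
        (Filter.Eventually.of_forall fun r => ?_)
      simp only [twoPoint, hf, Pi.sub_apply]
      rw [add_sub_right_comm]
    have := hm.hasDerivAt_eq_zero hd
    simp only [PiLp.sub_apply] at this
    simp only [q]
    linear_combination this
  -- second-order condition along the diagonal
  have hHess : ∀ i, (1 + s) * (H i x - D i x ^ 2) - (H i y - D i y ^ 2) - 2 * δ ≤ 0 :=
    fun i => by
    have hm : IsLocalMax (fun r : ℝ => twoPoint v s δ K (x + r • e i) (y + r • e i) t) 0 :=
      Filter.Eventually.of_forall fun r => by
        simpa using hmax (x + r • e i) (y + r • e i) t ht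
    have hd : ∀ r, HasDerivAt (fun r : ℝ => twoPoint v s δ K (x + r • e i) (y + r • e i) t)
        ((1 + s) * D i (x + r • e i) - D i (y + r • e i) - δ * (2 * x i + 2 * r)) r :=
      fun r => by
      have := ((((hline x i r).const_mul (1 + s)).sub (hline y i r)).sub_const
        ((1 + s) / s * (‖x - y‖ ^ 2 / t))).sub ((hquad x i r).const_mul δ) |>.sub_const
          (δ * K * t)
      refine this.congr_of_eventuallyEq (Filter.Eventually.of_forall fun r => ?_)
      simp only [twoPoint, hf, Pi.sub_apply]
      rw [add_sub_add_right_eq_sub]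
    refine nonpos_of_isLocalMax_of_hasDerivAt hm hd ?_
    have := (((hasDerivAt_deriv_log_comp_line hf2 hfpos x (e i)).const_mul (1 + s)).sub
      (hasDerivAt_deriv_log_comp_line hf2 hfpos y (e i))).sub
      ((((hasDerivAt_id (0 : ℝ)).const_mul 2).const_add (2 * x i)).const_mul δ)
    refine this.congr_deriv ?_
    simp only [H, D]
    ring
  -- time derivative
  have htime : 0 ≤ (1 + s) * ∑ i, H i x - ∑ i, H i y
      + (1 + s) / s * (‖x - y‖ ^ 2 / t ^ 2) - δ * K := by
    refine nonneg_of_hasDerivWithinAt_of_le ht ?_ (hmax x y)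
    have hlog := fun z => (hheat z t htI).log (hpos z t htI).ne'
    have h3 : HasDerivWithinAt (fun r : ℝ => ‖x - y‖ ^ 2 / r) (-(‖x - y‖ ^ 2 / t ^ 2))
        (Icc 0 T) t := by
      have := ((hasDerivAt_inv ht0.ne').const_mul (‖x - y‖ ^ 2)).hasDerivWithinAt (s := Icc 0 T)
      simp only [← div_eq_mul_inv] at this
      exact this.congr_deriv (by ring)
    have := (((((hlog x).const_mul (1 + s)).sub (hlog y)).sub (h3.const_mul ((1 + s) / s))).sub_const
      (δ * ‖x‖ ^ 2)).sub ((hasDerivWithinAt_id t (Icc 0 T)).const_mul (δ * K))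
    refine this.congr_deriv ?_
    rw [← hlapf, ← hlapf]
    ring
  have hnorm : (1 + s) / s * (‖x - y‖ ^ 2 / t ^ 2) = ∑ i, s / (4 * (1 + s)) * q i ^ 2 := by
    rw [EuclideanSpace.real_norm_sq_eq, Finset.sum_div, Finset.mul_sum]
    refine Finset.sum_congr rfl fun i _ => ?_
    simp only [q, PiLp.sub_apply]
    field_simp
    ring
  have hterm : ∀ i, (1 + s) * H i x - H i y + s / (4 * (1 + s)) * q i ^ 2
      ≤ 2 * δ + 4 * (1 + 4 / (3 * s)) * δ ^ 2 * x i ^ 2 := fun i => by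
    have h1 := hHess i
    have h2 := two_point_first_order_le (q := q i) (z := 2 * δ * x i) hs
    have h3 : (1 + s) * D i x ^ 2 = (q i - 2 * δ * x i) ^ 2 / (1 + s) := by
      rw [eq_div_iff (by positivity)]
      linear_combination ((1 + s) * D i x - q i + 2 * δ * x i) * hDx i
    rw [hDy i] at h1
    linarith
  have hsum := Finset.sum_le_sum fun i (_ : i ∈ Finset.univ) => hterm i
  simp only [Finset.sum_add_distrib, Finset.sum_sub_distrib, ← Finset.mul_sum] at hsum
  rw [← EuclideanSpace.real_norm_sq_eq] at hsum
  rw [← Finset.mul_sum] at hnorm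
  simp only [Finset.sum_const, Finset.card_univ, Fintype.card_fin, nsmul_eq_mul] at hsum
  refine le_of_mul_le_mul_left ?_ hδ
  linarith

theorem exists_twoPoint_isMax {n : ℕ} {T s δ K ε N t : ℝ}
    {v : EuclideanSpace ℝ (Fin n) → ℝ → ℝ} (hs : 0 < s) (hδ : 0 < δ) (hK : 0 ≤ K) (hε : 0 < ε)
    (hcont : ContinuousOn (fun p : EuclideanSpace ℝ (Fin n) × ℝ => v p.1 p.2)
      (univ ×ˢ Icc 0 T))
    (hlb : ∀ x, ∀ t ∈ Icc 0 T, ε ≤ v x t) (hub : ∀ x, ∀ t ∈ Icc 0 T, v x t ≤ N)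
    (ht : t ∈ Ioc 0 T) (x y : EuclideanSpace ℝ (Fin n))
    (hlt : s * Real.log N < twoPoint v s δ K x y t) :
    ∃ x₀ y₀, ∃ t₀ ∈ Ioc 0 T, δ * ‖x₀‖ ^ 2 ≤ Real.log N - Real.log ε ∧
      ∀ x' y', ∀ t' ∈ Ioc 0 T, twoPoint v s δ K x' y' t' ≤ twoPoint v s δ K x₀ y₀ t₀ := by
  set A := Real.log N - Real.log ε with hA
  set C := (1 + s) / s with hC
  have hC0 : 0 < C := by positivity
  let G : EuclideanSpace ℝ (Fin n) × EuclideanSpace ℝ (Fin n) × ℝ → ℝ := fun p =>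
    (1 + s) * Real.log (v p.1 p.2.2) - Real.log (v (p.1 + Real.sqrt p.2.2 • p.2.1) p.2.2)
      - C * ‖p.2.1‖ ^ 2 - δ * ‖p.1‖ ^ 2 - δ * K * p.2.2
  have hpos : ∀ x, ∀ t ∈ Icc 0 T, 0 < v x t := fun x t ht => hε.trans_le (hlb x t ht)
  have hGtwo : ∀ z w, ∀ r ∈ Ioc 0 T,
      G (z, w, r) = twoPoint v s δ K z (z + Real.sqrt r • w) r := fun z w r hr => by
    have h1 : ‖z - (z + Real.sqrt r • w)‖ ^ 2 / r = ‖w‖ ^ 2 := by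
      rw [sub_add_cancel_left, norm_neg, norm_smul, mul_pow, Real.norm_eq_abs, sq_abs,
        Real.sq_sqrt hr.1.le, mul_div_cancel_left₀ _ hr.1.ne']
    simp only [G, twoPoint, h1, hC]
  have hsurj : ∀ z z', ∀ r ∈ Ioc 0 T,
      twoPoint v s δ K z z' r = G (z, (Real.sqrt r)⁻¹ • (z' - z), r) := fun z z' r hr => by
    rw [hGtwo _ _ _ hr, smul_inv_smul₀ (Real.sqrt_pos.2 hr.1).ne', add_sub_cancel]
  have hlogub : ∀ z, ∀ r ∈ Icc 0 T, Real.log (v z r) ≤ Real.log N := fun z r hr =>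
    Real.log_le_log (hpos z r hr) (hub z r hr)
  have hloglb : ∀ z, ∀ r ∈ Icc 0 T, Real.log ε ≤ Real.log (v z r) := fun z r hr =>
    Real.log_le_log hε (hlb z r hr)
  have hGle : ∀ z w, ∀ r ∈ Icc 0 T,
      G (z, w, r) ≤ s * Real.log N + A - C * ‖w‖ ^ 2 - δ * ‖z‖ ^ 2 := fun z w r hr => by
    have h1 := mul_le_mul_of_nonneg_left (hlogub z r hr) (by linarith : 0 ≤ 1 + s)
    have h2 := hloglb (z + Real.sqrt r • w) r hr
    have h3 : 0 ≤ δ * K * r := mul_nonneg (by positivity) hr.1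
    simp only [G]
    linarith
  have hbdd : ∀ z w, ∀ r ∈ Icc 0 T, s * Real.log N < G (z, w, r) →
      C * ‖w‖ ^ 2 ≤ A ∧ δ * ‖z‖ ^ 2 ≤ A := fun z w r hr h => by
    have h1 := hGle z w r hr
    have h2 : 0 ≤ C * ‖w‖ ^ 2 := by positivity
    have h3 : 0 ≤ δ * ‖z‖ ^ 2 := by positivity
    constructor <;> linarith
  have hmem : ∀ {c : ℝ} (_ : 0 < c) (z : EuclideanSpace ℝ (Fin n)), c * ‖z‖ ^ 2 ≤ A →
      z ∈ Metric.closedBall (0 : EuclideanSpace ℝ (Fin n)) (Real.sqrt (A / c)) :=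
    fun hc z h => by
    rw [mem_closedBall_zero_iff]
    refine Real.le_sqrt_of_sq_le ?_
    rw [le_div_iff₀ hc]
    linarith
  set S : Set (EuclideanSpace ℝ (Fin n) × EuclideanSpace ℝ (Fin n) × ℝ) :=
    Metric.closedBall 0 (Real.sqrt (A / δ)) ×ˢ Metric.closedBall 0 (Real.sqrt (A / C)) ×ˢ
      Icc 0 T with hS
  have hScomp : IsCompact S :=
    (isCompact_closedBall _ _).prod ((isCompact_closedBall _ _).prod isCompact_Icc)
  have hGcont : ContinuousOn G S := by
    have h1 : ContinuousOn (fun p : EuclideanSpace ℝ (Fin n) × EuclideanSpace ℝ (Fin n) × ℝ =>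
        v p.1 p.2.2) S :=
      hcont.comp (f := fun p : EuclideanSpace ℝ (Fin n) × EuclideanSpace ℝ (Fin n) × ℝ =>
        (p.1, p.2.2)) (by fun_prop) fun p hp => ⟨mem_univ _, hp.2.2⟩
    have h2 : ContinuousOn (fun p : EuclideanSpace ℝ (Fin n) × EuclideanSpace ℝ (Fin n) × ℝ =>
        v (p.1 + Real.sqrt p.2.2 • p.2.1) p.2.2) S :=
      hcont.comp (f := fun p : EuclideanSpace ℝ (Fin n) × EuclideanSpace ℝ (Fin n) × ℝ =>
        (p.1 + Real.sqrt p.2.2 • p.2.1, p.2.2)) (by fun_prop) fun p hp => ⟨mem_univ _, hp.2.2⟩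
    have h3 := h1.log fun p hp => (hpos _ _ hp.2.2).ne'
    have h4 := h2.log fun p hp => (hpos _ _ hp.2.2).ne'
    simp only [G]
    fun_prop
  have hlt' := hlt
  rw [hsurj x y t ht] at hlt'
  have htI : t ∈ Icc 0 T := ⟨ht.1.le, ht.2⟩
  have hb := hbdd _ _ _ htI hlt'
  have hpS : (x, (Real.sqrt t)⁻¹ • (y - x), t) ∈ S :=
    ⟨hmem hδ _ hb.2, hmem hC0 _ hb.1, htI⟩
  obtain ⟨⟨x₀, w₀, t₀⟩, ⟨_, _, ht₀⟩, hmax⟩ := hScomp.exists_isMaxOn ⟨_, hpS⟩ hGcont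
  simp only at ht₀
  have hlt₀ : s * Real.log N < G (x₀, w₀, t₀) := hlt'.trans_le (hmax hpS)
  have ht₀pos : 0 < t₀ := by
    refine lt_of_le_of_ne ht₀.1 fun h0 => ?_
    subst h0
    have h1 := mul_le_mul_of_nonneg_left (hlogub x₀ 0 ht₀) hs.le
    have h2 : 0 ≤ C * ‖w₀‖ ^ 2 := by positivity
    have h3 : 0 ≤ δ * ‖x₀‖ ^ 2 := by positivity
    simp only [G, Real.sqrt_zero, zero_smul, add_zero, mul_zero] at hlt₀
    linarith
  have ht₀' : t₀ ∈ Ioc 0 T := ⟨ht₀pos, ht₀.2⟩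
  refine ⟨x₀, x₀ + Real.sqrt t₀ • w₀, t₀, ht₀', (hbdd _ _ _ ht₀ hlt₀).2, fun x' y' t' ht' => ?_⟩
  rw [← hGtwo _ _ _ ht₀', hsurj x' y' t' ht']
  have htI' : t' ∈ Icc 0 T := ⟨ht'.1.le, ht'.2⟩
  by_cases h : s * Real.log N < G (x', (Real.sqrt t')⁻¹ • (y' - x'), t')
  · have hb' := hbdd _ _ _ htI' h
    exact hmax (show _ ∈ S from ⟨hmem hδ _ hb'.2, hmem hC0 _ hb'.1, htI'⟩)
  · exact (not_lt.1 h).trans hlt₀.le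

/-- A log-Harnack inequality for solutions of the heat equation that are bounded above and
bounded away from zero. -/
theorem log_harnack_of_bounds {n : ℕ} {T s ε N : ℝ}
    {v : EuclideanSpace ℝ (Fin n) → ℝ → ℝ} (hs : 0 < s) (hε : 0 < ε)
    (hcont : ContinuousOn (fun p : EuclideanSpace ℝ (Fin n) × ℝ => v p.1 p.2)
      (univ ×ˢ Icc 0 T))
    (hcd : ∀ t ∈ Icc 0 T, ContDiff ℝ 2 fun x => v x t)
    (hlb : ∀ x, ∀ t ∈ Icc 0 T, ε ≤ v x t) (hub : ∀ x, ∀ t ∈ Icc 0 T, v x t ≤ N)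
    (hheat : ∀ x, ∀ t ∈ Icc 0 T,
      HasDerivWithinAt (fun r => v x r) (lap (fun y => v y t) x) (Icc 0 T) t)
    {t : ℝ} (ht : t ∈ Ioc 0 T) (x y : EuclideanSpace ℝ (Fin n)) :
    (1 + s) * Real.log (v x t) - Real.log (v y t)
      ≤ s * Real.log N + (1 + s) / s * (‖x - y‖ ^ 2 / t) := by
  have htI : t ∈ Icc 0 T := ⟨ht.1.le, ht.2⟩
  set A := Real.log N - Real.log ε
  have hA : 0 ≤ A := sub_nonneg.2
    (Real.log_le_log hε ((hlb x t htI).trans (hub x t htI)))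
  set K := 2 * n + 4 * (1 + 4 / (3 * s)) * A + 1 with hK
  have hK0 : 0 ≤ K := by positivity
  have key : ∀ δ, 0 < δ → twoPoint v s δ K x y t ≤ s * Real.log N := fun δ hδ => by
    by_contra! h
    obtain ⟨x₀, y₀, t₀, ht₀, hx₀, hmax⟩ :=
      exists_twoPoint_isMax hs hδ hK0 hε hcont hlb hub ht x y h
    have h1 := le_of_twoPoint_isMax hs hδ hcd
      (fun x t ht => hε.trans_le (hlb x t ht)) hheat ht₀ x₀ y₀ hmax
    have h2 : 4 * (1 + 4 / (3 * s)) * (δ * ‖x₀‖ ^ 2) ≤ 4 * (1 + 4 / (3 * s)) * A := by gcongr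
    linarith
  have hB : 0 ≤ ‖x‖ ^ 2 + K * t := add_nonneg (by positivity) (mul_nonneg hK0 ht.1.le)
  refine le_of_forall_pos_le_add fun η hη => ?_
  have h1 := key (η / (‖x‖ ^ 2 + K * t + 1)) (by positivity)
  have h2 : η / (‖x‖ ^ 2 + K * t + 1) * (‖x‖ ^ 2 + K * t) ≤ η := by
    rw [div_mul_eq_mul_div, div_le_iff₀ (by positivity)]
    nlinarith
  simp only [twoPoint] at h1
  linarith

theorem lap_add_const {n : ℕ} (f : EuclideanSpace ℝ (Fin n) → ℝ) (c : ℝ) :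
    lap (fun y => f y + c) = lap f := by
  funext x
  simp only [lap, fderiv_add_const]

/-- Integrated form of Hamilton's gradient estimate: for a positive bounded
solution `u` of the heat equation on ℝⁿ × [0,T] with `0 < u ≤ M`,
`√(log(M/u(x,t))) ≤ √(log(M/u(y,t))) + ‖x − y‖/√t` for `t ∈ (0,T]`. -/
theorem hamilton_gradient_estimate_integrated
    (n : ℕ) (hn : 1 ≤ n) (T M : ℝ) (hT : 0 < T) (hM : 0 < M)
    (u : EuclideanSpace ℝ (Fin n) → ℝ → ℝ)
    (hsmooth : ContDiffOn ℝ (⊤ : ℕ∞)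
      (fun p : EuclideanSpace ℝ (Fin n) × ℝ => u p.1 p.2) (univ ×ˢ Icc 0 T))
    (hpos : ∀ x, ∀ t ∈ Icc (0 : ℝ) T, 0 < u x t)
    (hbound : ∀ x, ∀ t ∈ Icc (0 : ℝ) T, u x t ≤ M)
    (hheat : ∀ x, ∀ t ∈ Icc (0 : ℝ) T,
      derivWithin (fun s => u x s) (Icc 0 T) t = lap (fun y => u y t) x) :
    ∀ x y : EuclideanSpace ℝ (Fin n), ∀ t ∈ Ioc (0 : ℝ) T,
      Real.sqrt (Real.log (M / u x t))
        ≤ Real.sqrt (Real.log (M / u y t)) + ‖x - y‖ / Real.sqrt t := by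
  intro x y t ht
  have htI : t ∈ Icc 0 T := ⟨ht.1.le, ht.2⟩
  have hlog : ∀ z, Real.log (M / u z t) = Real.log M - Real.log (u z t) := fun z =>
    Real.log_div hM.ne' (hpos z t htI).ne'
  have hcd : ∀ r ∈ Icc 0 T, ContDiff ℝ 2 fun z => u z r := fun r hr =>
    contDiffOn_univ.1 <| (contDiffOn_infty.1 hsmooth 2).comp
      (f := fun z : EuclideanSpace ℝ (Fin n) => (z, r)) (by fun_prop)
      fun z _ => ⟨mem_univ _, hr⟩
  have hderiv : ∀ z, ∀ r ∈ Icc 0 T,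
      HasDerivWithinAt (fun r => u z r) (lap (fun y => u y r) z) (Icc 0 T) r :=
    fun z r hr => by
    rw [← hheat z r hr]
    have h : ContDiffOn ℝ (⊤ : ℕ∞) (fun r => u z r) (Icc 0 T) :=
      hsmooth.comp (f := fun r : ℝ => (z, r)) (by fun_prop) fun r hr => ⟨mem_univ _, hr⟩
    exact (h.differentiableOn (by simp) r hr).hasDerivWithinAt
  rw [hlog x, hlog y]
  refine sqrt_le_sqrt_add_of_forall
    (sub_nonneg.2 (Real.log_le_log (hpos y t htI) (hbound y t htI))) (by positivity)
    fun s hs => ?_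
  have hineq : ∀ ε ∈ Ioi (0 : ℝ), (1 + s) * Real.log (u y t + ε) - Real.log (u x t + ε)
      ≤ s * Real.log (M + ε) + (1 + s) / s * (‖y - x‖ ^ 2 / t) := fun ε hε =>
    log_harnack_of_bounds (v := fun z r => u z r + ε) hs hε
      (hsmooth.continuousOn.add continuousOn_const)
      (fun r hr => (hcd r hr).add contDiff_const)
      (fun z r hr => by linarith [hpos z r hr]) (fun z r hr => by linarith [hbound z r hr])
      (fun z r hr => by
        rw [lap_add_const]
        exact (hderiv z r hr).add_const ε) ht y x
  have htend : ∀ a : ℝ, 0 < a → Filter.Tendsto (fun ε : ℝ => Real.log (a + ε))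
      (nhdsWithin 0 (Ioi 0)) (nhds (Real.log a)) := fun a ha => by
    have h : ContinuousAt (fun ε : ℝ => Real.log (a + ε)) 0 :=
      ContinuousAt.log (by fun_prop) (by simpa using ha.ne')
    simpa using h.tendsto.mono_left (nhdsWithin_le_nhds (s := Ioi 0))
  have hlim := le_of_tendsto_of_tendsto
    (((htend _ (hpos y t htI)).const_mul (1 + s)).sub (htend _ (hpos x t htI)))
    (((htend M hM).const_mul s).add_const _)
    (Filter.eventually_of_mem self_mem_nhdsWithin hineq)
  rw [div_pow, Real.sq_sqrt ht.1.le, norm_sub_rev x y]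
  linarith
end

section
/- For every δ > 0 there exist positive constants c₁ and c₂ depending only on δ with the following property. Let n ≥ 1, T > 0 and M > 0, and let u : ℝⁿ × [0,T] → ℝ be a smooth positive solution of the heat equation ∂ₜu = Δu on ℝⁿ × [0,T] satisfying 0 < u ≤ M everywhere. Then for every x, y ∈ ℝⁿ and every t ∈ (0,T], one has u(y,t) ≤ c₁ · u(x,t)^{1/(1+δ)} · M^{δ/(1+δ)} · exp(c₂ ‖x − y‖² / t). -/
open Set

theorem IsLocalMax.second_deriv_nonpos {φ φ' : ℝ → ℝ} {x d : ℝ} (hmax : IsLocalMax φ x)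
    (hφ : ∀ s, HasDerivAt φ (φ' s) s) (hφ' : HasDerivAt φ' d x) : d ≤ 0 := by
  by_contra! hd
  have hderiv : deriv φ = φ' := funext fun s => (hφ s).deriv
  have hmin : IsLocalMin φ x :=
    isLocalMin_of_deriv_deriv_pos (by rwa [hderiv, hφ'.deriv]) hmax.deriv_eq_zero
      (hφ x).continuousAt
  have hconst : φ =ᶠ[nhds x] fun _ => φ x := by
    filter_upwards [hmax, hmin] with s h₁ h₂ using le_antisymm h₁ h₂
  have hzero : deriv (deriv φ) x = 0 := by
    rw [hconst.deriv.deriv_eq]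
    simp
  rw [hderiv, hφ'.deriv] at hzero
  exact hd.ne' hzero

section Line

variable {n : ℕ} {f : EuclideanSpace ℝ (Fin n) → ℝ}

theorem hasDerivAt_line_single (i : Fin n) (x : EuclideanSpace ℝ (Fin n)) (s : ℝ) :
    HasDerivAt (fun s : ℝ => x + s • EuclideanSpace.single i (1 : ℝ))
      (EuclideanSpace.single i 1) s := by
  simpa using ((hasDerivAt_id s).smul_const (EuclideanSpace.single i (1 : ℝ))).const_add x

theorem hasDerivAt_norm_sq_line (i : Fin n) (x : EuclideanSpace ℝ (Fin n)) (s : ℝ) :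
    HasDerivAt (fun s : ℝ => ‖x + s • EuclideanSpace.single i (1 : ℝ)‖ ^ 2)
      (2 * (x i + s)) s := by
  have h := (hasDerivAt_line_single i x s).norm_sq
  simpa [inner_add_left, inner_smul_left, EuclideanSpace.inner_single_right] using h

theorem hasDerivAt_log_line (hf : Differentiable ℝ f) (hpos : ∀ x, 0 < f x) (i : Fin n)
    (x : EuclideanSpace ℝ (Fin n)) (s : ℝ) :
    HasDerivAt (fun s : ℝ => Real.log (f (x + s • EuclideanSpace.single i (1 : ℝ))))
      (fderiv ℝ f (x + s • EuclideanSpace.single i (1 : ℝ)) (EuclideanSpace.single i 1) /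
        f (x + s • EuclideanSpace.single i (1 : ℝ))) s :=
  ((hf _).hasFDerivAt.comp_hasDerivAt s (hasDerivAt_line_single i x s)).log (hpos _).ne'

theorem hasDerivAt_deriv_log_line (hf : ContDiff ℝ 2 f) (hpos : ∀ x, 0 < f x) (i : Fin n)
    (x : EuclideanSpace ℝ (Fin n)) :
    HasDerivAt (fun s : ℝ =>
      fderiv ℝ f (x + s • EuclideanSpace.single i (1 : ℝ)) (EuclideanSpace.single i 1) /
        f (x + s • EuclideanSpace.single i (1 : ℝ)))
      (fderiv ℝ (fun y => fderiv ℝ f y (EuclideanSpace.single i 1)) x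
        (EuclideanSpace.single i 1) / f x -
        (fderiv ℝ f x (EuclideanSpace.single i 1) / f x) ^ 2) 0 := by
  have hd : Differentiable ℝ (fun y => fderiv ℝ f y (EuclideanSpace.single i 1)) :=
    ((hf.fderiv_right (m := 1) (by norm_num)).clm_apply contDiff_const).differentiable
      (by norm_num)
  have hl := hasDerivAt_line_single i x 0
  have h₁ := (hd _).hasFDerivAt.comp_hasDerivAt 0 hl
  have h₂ := (hf.differentiable (by norm_num) _).hasFDerivAt.comp_hasDerivAt 0 hl
  have h := h₁.div h₂ (hpos _).ne'
  have hx := (hpos x).ne'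
  refine h.congr_deriv ?_
  simp only [Function.comp_apply, zero_smul, add_zero]
  field_simp

/-- Second-order condition at a maximum of the doubled function
`log f y - a log f x - c ‖x - y‖² - κ ‖x‖²`. -/
theorem lap_div_sub_le_of_forall_le (hf : ContDiff ℝ 2 f) (hpos : ∀ x, 0 < f x)
    {a c κ : ℝ} (ha : 0 < a) {x y : EuclideanSpace ℝ (Fin n)}
    (hmax : ∀ x' y', Real.log (f y') - a * Real.log (f x') - c * ‖x' - y'‖ ^ 2 - κ * ‖x'‖ ^ 2 ≤
      Real.log (f y) - a * Real.log (f x) - c * ‖x - y‖ ^ 2 - κ * ‖x‖ ^ 2) :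
    lap f y / f y - a * (lap f x / f x) ≤
      ∑ i, ((2 * c * (y i - x i)) ^ 2 - (2 * c * (y i - x i) - 2 * κ * x i) ^ 2 / a + 2 * κ) := by
  have hd := hf.differentiable (by norm_num)
  simp only [lap, Finset.sum_div, Finset.mul_sum]
  rw [← Finset.sum_sub_distrib]
  refine Finset.sum_le_sum fun i _ => ?_
  set e : EuclideanSpace ℝ (Fin n) := EuclideanSpace.single i 1 with he
  have hy : fderiv ℝ f y e / f y = 2 * c * (y i - x i) := by
    have h := ((hasDerivAt_log_line hd hpos i y 0).sub
      ((hasDerivAt_norm_sq_line i (y - x) 0).const_mul c))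
    have hm : IsLocalMax (fun s : ℝ => Real.log (f (y + s • e)) -
        c * ‖(y - x) + s • e‖ ^ 2) 0 := by
      refine Filter.Eventually.of_forall fun s => ?_
      have := hmax x (y + s • e)
      rw [norm_sub_rev x, norm_sub_rev x, add_sub_right_comm] at this
      simp only [zero_smul, add_zero]
      linarith
    have h0 := hm.hasDerivAt_eq_zero h
    simp only [zero_smul, add_zero, PiLp.sub_apply] at h0
    linarith
  have hx : fderiv ℝ f x e / f x = (2 * c * (y i - x i) - 2 * κ * x i) / a := by
    have h := (((hasDerivAt_log_line hd hpos i x 0).const_mul a).add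
      ((hasDerivAt_norm_sq_line i (x - y) 0).const_mul c)).add
      ((hasDerivAt_norm_sq_line i x 0).const_mul κ)
    have hm : IsLocalMin (fun s : ℝ => a * Real.log (f (x + s • e)) +
        c * ‖(x - y) + s • e‖ ^ 2 + κ * ‖x + s • e‖ ^ 2) 0 := by
      refine Filter.Eventually.of_forall fun s => ?_
      have := hmax (x + s • e) y
      rw [add_sub_right_comm] at this
      simp only [zero_smul, add_zero]
      linarith
    have h0 := hm.hasDerivAt_eq_zero h
    simp only [zero_smul, add_zero, PiLp.sub_apply] at h0
    rw [eq_div_iff ha.ne']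
    linarith
  have hm : IsLocalMax (fun s : ℝ => Real.log (f (y + s • e)) -
      a * Real.log (f (x + s • e)) - κ * ‖x + s • e‖ ^ 2) 0 := by
    refine Filter.Eventually.of_forall fun s => ?_
    have := hmax (x + s • e) (y + s • e)
    rw [add_sub_add_right_eq_sub] at this
    simp only [zero_smul, add_zero]
    linarith
  have hlin : HasDerivAt (fun s : ℝ => 2 * (x i + s)) 2 0 := by
    simpa using ((hasDerivAt_id (0 : ℝ)).const_add (x i)).const_mul 2
  have h := hm.second_deriv_nonpos
    (fun s => ((hasDerivAt_log_line hd hpos i y s).sub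
      ((hasDerivAt_log_line hd hpos i x s).const_mul a)).sub
      ((hasDerivAt_norm_sq_line i x s).const_mul κ))
    (((hasDerivAt_deriv_log_line hf hpos i y).sub
      ((hasDerivAt_deriv_log_line hf hpos i x).const_mul a)).sub (hlin.const_mul κ))
  rw [← he, hx, hy] at h
  have hsq : a * ((2 * c * (y i - x i) - 2 * κ * x i) / a) ^ 2 =
      (2 * c * (y i - x i) - 2 * κ * x i) ^ 2 / a := by
    field_simp
  linarith

end Line

theorem sq_mul_sub_le {δ : ℝ} (hδ : 0 < δ) (p k : ℝ) :
    p ^ 2 * (1 + δ / 2) - (1 + δ) * (p - k) ^ 2 ≤ 2 * (1 + δ) ^ 2 / δ * k ^ 2 := by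
  have h : 2 * (1 + δ) ^ 2 / δ * k ^ 2 - (p ^ 2 * (1 + δ / 2) - (1 + δ) * (p - k) ^ 2) =
      (δ * p - 2 * (1 + δ) * k) ^ 2 / (2 * δ) + (1 + δ) * k ^ 2 := by
    field_simp
    ring
  have : 0 ≤ (δ * p - 2 * (1 + δ) * k) ^ 2 / (2 * δ) + (1 + δ) * k ^ 2 := by positivity
  linarith

theorem derivWithin_nonneg_of_isMaxOn {h : ℝ → ℝ} {T t h' : ℝ} (ht : t ∈ Ioc 0 T)
    (hmax : IsMaxOn h (Icc 0 T) t) (hd : HasDerivWithinAt h h' (Icc 0 T) t) : 0 ≤ h' := by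
  have hcone : (0 - t) ∈ posTangentConeAt (Icc 0 T) t :=
    mem_posTangentConeAt_of_segment_subset (by
      rw [add_sub_cancel]
      exact (convex_Icc 0 T).segment_subset (Ioc_subset_Icc_self ht) ⟨le_rfl, ht.1.le.trans ht.2⟩)
  have := hmax.localize.hasFDerivWithinAt_nonpos hd.hasFDerivWithinAt hcone
  simp only [zero_sub, ContinuousLinearMap.toSpanSingleton_apply, smul_eq_mul] at this
  nlinarith [ht.1]

/-- A solution of the heat equation on `ℝⁿ × [0,T]` with values in `[ε, M]` and the regularity
needed for the maximum principle. -/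
structure IsBoundedHeatSolution {n : ℕ} (w : EuclideanSpace ℝ (Fin n) → ℝ → ℝ)
    (T ε M : ℝ) : Prop where
  continuousOn : ContinuousOn (fun p : EuclideanSpace ℝ (Fin n) × ℝ => w p.1 p.2)
    (univ ×ˢ Icc 0 T)
  contDiff : ∀ t ∈ Icc 0 T, ContDiff ℝ 2 fun x => w x t
  hasDerivWithinAt : ∀ x, ∀ t ∈ Icc 0 T,
    HasDerivWithinAt (fun s => w x s) (lap (fun y => w y t) x) (Icc 0 T) t
  le : ∀ x, ∀ t ∈ Icc 0 T, ε ≤ w x t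
  ge : ∀ x, ∀ t ∈ Icc 0 T, w x t ≤ M

namespace IsBoundedHeatSolution

variable {n : ℕ} {w : EuclideanSpace ℝ (Fin n) → ℝ → ℝ} {T ε M : ℝ}

/-- The doubled function cannot have a maximum at a positive time. -/
theorem time_eq_zero_of_max (hw : IsBoundedHeatSolution w T ε M) (hε : 0 < ε)
    {δ κ σ l : ℝ} (hδ : 0 < δ) (hσ : 0 < σ)
    {x y : EuclideanSpace ℝ (Fin n)} {t : ℝ} (ht : t ∈ Icc 0 T)
    (hl : 2 * n * κ + 8 * (1 + δ) ^ 2 / δ * κ ^ 2 * ‖x‖ ^ 2 < l)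
    (hmax : ∀ x' y', ∀ t' ∈ Icc 0 T,
      Real.log (w y' t') - 1 / (1 + δ) * Real.log (w x' t') -
        1 / (2 * δ) * ‖x' - y'‖ ^ 2 / (t' + σ) - κ * ‖x'‖ ^ 2 - l * t' ≤
      Real.log (w y t) - 1 / (1 + δ) * Real.log (w x t) -
        1 / (2 * δ) * ‖x - y‖ ^ 2 / (t + σ) - κ * ‖x‖ ^ 2 - l * t) : t = 0 := by
  by_contra ht0
  have htpos : 0 < t := lt_of_le_of_ne ht.1 (Ne.symm ht0)
  have hτ : 0 < t + σ := by linarith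
  have hpos : ∀ z, 0 < w z t := fun z => hε.trans_le (hw.le z t ht)
  have hspace := lap_div_sub_le_of_forall_le (c := 1 / (2 * δ) / (t + σ)) (κ := κ)
    (hw.contDiff t ht) hpos (a := 1 / (1 + δ)) (by positivity) (x := x) (y := y)
    (fun x' y' => by
      have := hmax x' y' t ht
      rw [mul_div_right_comm, mul_div_right_comm (1 / (2 * δ))] at this
      linarith)
  have hfrac : HasDerivWithinAt (fun s => 1 / (2 * δ) * ‖x - y‖ ^ 2 / (s + σ))
      (-(1 / (2 * δ) * ‖x - y‖ ^ 2) / (t + σ) ^ 2) (Icc 0 T) t :=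
    (((hasDerivAt_const t (1 / (2 * δ) * ‖x - y‖ ^ 2)).div
      ((hasDerivAt_id t).add_const σ) hτ.ne').congr_deriv (by simp)).hasDerivWithinAt
  have hlin : HasDerivWithinAt (fun s => l * s) l (Icc 0 T) t := by
    simpa using ((hasDerivAt_id t).const_mul l).hasDerivWithinAt (s := Icc 0 T)
  have htime := derivWithin_nonneg_of_isMaxOn ⟨htpos, ht.2⟩ (fun s hs => hmax x y s hs)
    ((((((hw.hasDerivWithinAt y t ht).log (hpos y).ne').sub
      (((hw.hasDerivWithinAt x t ht).log (hpos x).ne').const_mul (1 / (1 + δ)))).sub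
      hfrac).sub_const (κ * ‖x‖ ^ 2)).sub hlin)
  have hsum : ∑ i, ((2 * (1 / (2 * δ) / (t + σ)) * (y i - x i)) ^ 2 -
        (2 * (1 / (2 * δ) / (t + σ)) * (y i - x i) - 2 * κ * x i) ^ 2 / (1 / (1 + δ)) + 2 * κ) +
      1 / (2 * δ) * ‖x - y‖ ^ 2 / (t + σ) ^ 2 ≤
      2 * n * κ + 8 * (1 + δ) ^ 2 / δ * κ ^ 2 * ‖x‖ ^ 2 := by
    have hrhs : 2 * n * κ + 8 * (1 + δ) ^ 2 / δ * κ ^ 2 * ‖x‖ ^ 2 =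
        ∑ i, (2 * κ + 2 * (1 + δ) ^ 2 / δ * (2 * κ * x i) ^ 2) := by
      rw [EuclideanSpace.real_norm_sq_eq, Finset.sum_add_distrib, Finset.mul_sum]
      simp only [Finset.sum_const, Finset.card_univ, Fintype.card_fin, nsmul_eq_mul]
      congr 1
      · ring
      · exact Finset.sum_congr rfl fun i _ => by ring
    rw [hrhs, EuclideanSpace.real_norm_sq_eq, Finset.mul_sum, Finset.sum_div,
      ← Finset.sum_add_distrib]
    refine Finset.sum_le_sum fun i _ => ?_
    have h := sq_mul_sub_le hδ (2 * (1 / (2 * δ) / (t + σ)) * (y i - x i)) (2 * κ * x i)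
    have h₁ : 1 / (2 * δ) * (x - y) i ^ 2 / (t + σ) ^ 2 =
        (2 * (1 / (2 * δ) / (t + σ)) * (y i - x i)) ^ 2 * (δ / 2) := by
      rw [PiLp.sub_apply]
      field_simp
      ring
    have h₂ : (2 * (1 / (2 * δ) / (t + σ)) * (y i - x i) - 2 * κ * x i) ^ 2 / (1 / (1 + δ)) =
        (1 + δ) * (2 * (1 / (2 * δ) / (t + σ)) * (y i - x i) - 2 * κ * x i) ^ 2 := by
      rw [div_div_eq_mul_div, div_one, mul_comm]
    rw [h₁, h₂]
    linarith
  rw [neg_div] at htime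
  linarith

theorem exists_max (hw : IsBoundedHeatSolution w T ε M) (hε : 0 < ε) (hT : 0 < T)
    {δ κ σ l : ℝ} (hδ : 0 < δ) (hκ : 0 < κ) (hσ : 0 < σ) (hl : 0 ≤ l) :
    ∃ x y, ∃ t ∈ Icc 0 T, κ * ‖x‖ ^ 2 ≤ Real.log M - Real.log ε ∧
      ∀ x' y', ∀ t' ∈ Icc 0 T,
      Real.log (w y' t') - 1 / (1 + δ) * Real.log (w x' t') -
        1 / (2 * δ) * ‖x' - y'‖ ^ 2 / (t' + σ) - κ * ‖x'‖ ^ 2 - l * t' ≤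
      Real.log (w y t) - 1 / (1 + δ) * Real.log (w x t) -
        1 / (2 * δ) * ‖x - y‖ ^ 2 / (t + σ) - κ * ‖x‖ ^ 2 - l * t := by
  set B := Real.log M - Real.log ε with hB
  set Z : EuclideanSpace ℝ (Fin n) → EuclideanSpace ℝ (Fin n) → ℝ → ℝ := fun x y t =>
    Real.log (w y t) - 1 / (1 + δ) * Real.log (w x t) -
        1 / (2 * δ) * ‖x - y‖ ^ 2 / (t + σ) - κ * ‖x‖ ^ 2 - l * t with hZ
  change ∃ x y, ∃ t ∈ Icc 0 T, κ * ‖x‖ ^ 2 ≤ B ∧ ∀ x' y', ∀ t' ∈ Icc 0 T, Z x' y' t' ≤ Z x y t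
  have h0 : (0 : ℝ) ∈ Icc 0 T := ⟨le_rfl, hT.le⟩
  have hlow : ∀ x, ∀ t ∈ Icc 0 T, Real.log ε ≤ Real.log (w x t) := fun x t ht =>
    Real.log_le_log hε (hw.le x t ht)
  have hup : ∀ x, ∀ t ∈ Icc 0 T, Real.log (w x t) ≤ Real.log M := fun x t ht =>
    Real.log_le_log (hε.trans_le (hw.le x t ht)) (hw.ge x t ht)
  have ha : 0 < 1 / (1 + δ) := by positivity
  have ha1 : 1 / (1 + δ) ≤ 1 := by
    rw [div_le_one (by positivity)]
    linarith
  have hB0 : 0 ≤ B := sub_nonneg.2 ((hlow 0 0 h0).trans (hup 0 0 h0))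
  have hcoer : ∀ x y, ∀ t ∈ Icc 0 T, Z 0 0 0 ≤ Z x y t →
      κ * ‖x‖ ^ 2 ≤ B ∧ 1 / (2 * δ) * ‖x - y‖ ^ 2 / (T + σ) ≤ B := by
    intro x y t ht hle
    have hτ : 0 < t + σ := by linarith [ht.1]
    have e₁ : 1 / (2 * δ) * ‖x - y‖ ^ 2 / (T + σ) ≤ 1 / (2 * δ) * ‖x - y‖ ^ 2 / (t + σ) :=
      div_le_div_of_nonneg_left (by positivity) hτ (by linarith [ht.2])
    have e₂ : 0 ≤ l * t := mul_nonneg hl ht.1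
    have e₃ : 0 ≤ κ * ‖x‖ ^ 2 := by positivity
    have e₄ : 0 ≤ 1 / (2 * δ) * ‖x - y‖ ^ 2 / (T + σ) := by positivity
    have e₅ := mul_le_mul_of_nonneg_left (hlow x t ht) ha.le
    have e₆ := mul_le_mul_of_nonneg_left (hlow 0 0 h0) (sub_nonneg.2 ha1)
    have e₇ := hup y t ht
    simp only [hZ, sub_self, norm_zero, ne_eq, OfNat.ofNat_ne_zero, not_false_eq_true, zero_pow,
      mul_zero, zero_div, sub_zero] at hle
    constructor <;> linarith
  set R := √(B / κ) with hR
  set R' := R + √(B * (T + σ) * (2 * δ)) with hR'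
  have hbound : ∀ x y, ∀ t ∈ Icc 0 T, Z 0 0 0 ≤ Z x y t → ‖x‖ ≤ R ∧ ‖y‖ ≤ R' := by
    intro x y t ht hle
    obtain ⟨h₁, h₂⟩ := hcoer x y t ht hle
    have hx : ‖x‖ ≤ R := Real.le_sqrt_of_sq_le (by rwa [le_div_iff₀' hκ])
    have hxy : ‖x - y‖ ≤ √(B * (T + σ) * (2 * δ)) := by
      refine Real.le_sqrt_of_sq_le ?_
      rw [div_le_iff₀ (by positivity), one_div, inv_mul_le_iff₀ (by positivity)] at h₂
      linarith
    refine ⟨hx, ?_⟩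
    have := norm_sub_le x (x - y)
    rw [sub_sub_cancel] at this
    linarith
  have hpos : ∀ x, ∀ t ∈ Icc 0 T, w x t ≠ 0 := fun x t ht => (hε.trans_le (hw.le x t ht)).ne'
  set K := (Metric.closedBall (0 : EuclideanSpace ℝ (Fin n)) R ×ˢ
    Metric.closedBall (0 : EuclideanSpace ℝ (Fin n)) R') ×ˢ Icc 0 T with hK
  have hcont : ContinuousOn (fun q : (EuclideanSpace ℝ (Fin n) × EuclideanSpace ℝ (Fin n)) × ℝ =>
      Z q.1.1 q.1.2 q.2) K := by
    have hx : ContinuousOn (fun q : (EuclideanSpace ℝ (Fin n) × EuclideanSpace ℝ (Fin n)) × ℝ =>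
        Real.log (w q.1.1 q.2)) K :=
      (hw.continuousOn.comp (f := fun q : (EuclideanSpace ℝ (Fin n) ×
        EuclideanSpace ℝ (Fin n)) × ℝ => (q.1.1, q.2)) (by fun_prop)
        fun q hq => ⟨mem_univ _, hq.2⟩).log fun q hq => hpos _ _ hq.2
    have hy : ContinuousOn (fun q : (EuclideanSpace ℝ (Fin n) × EuclideanSpace ℝ (Fin n)) × ℝ =>
        Real.log (w q.1.2 q.2)) K :=
      (hw.continuousOn.comp (f := fun q : (EuclideanSpace ℝ (Fin n) ×
        EuclideanSpace ℝ (Fin n)) × ℝ => (q.1.2, q.2)) (by fun_prop)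
        fun q hq => ⟨mem_univ _, hq.2⟩).log fun q hq => hpos _ _ hq.2
    have hfrac : ContinuousOn (fun q : (EuclideanSpace ℝ (Fin n) ×
        EuclideanSpace ℝ (Fin n)) × ℝ =>
        1 / (2 * δ) * ‖q.1.1 - q.1.2‖ ^ 2 / (q.2 + σ)) K :=
      ContinuousOn.div (by fun_prop) (by fun_prop) fun q hq => by
        have := hq.2.1
        positivity
    exact (((hy.sub (hx.const_mul _)).sub hfrac).sub (by fun_prop)).sub (by fun_prop)
  have hR0 : 0 ≤ R := Real.sqrt_nonneg _
  have hR0' : 0 ≤ R' := add_nonneg hR0 (Real.sqrt_nonneg _)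
  have h0K : ((0, 0), 0) ∈ K := ⟨⟨by simpa using hR0, by simpa using hR0'⟩, h0⟩
  obtain ⟨q, hq, hqmax⟩ := (((isCompact_closedBall _ _).prod (isCompact_closedBall _ _)).prod
    isCompact_Icc).exists_isMaxOn ⟨_, h0K⟩ hcont
  have hq0 : Z 0 0 0 ≤ Z q.1.1 q.1.2 q.2 := hqmax h0K
  refine ⟨q.1.1, q.1.2, q.2, hq.2, (hcoer _ _ _ hq.2 hq0).1, fun x y t ht => ?_⟩
  by_cases hle : Z 0 0 0 ≤ Z x y t
  · obtain ⟨hx, hy⟩ := hbound x y t ht hle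
    exact hqmax (⟨⟨mem_closedBall_zero_iff.2 hx, mem_closedBall_zero_iff.2 hy⟩, ht⟩ :
      ((x, y), t) ∈ K)
  · exact (not_le.1 hle).le.trans hq0

/-- For small `σ` the doubled function is almost nonpositive at the initial time. -/
theorem exists_initial_bound (hw : IsBoundedHeatSolution w T ε M) (hε : 0 < ε) (hT : 0 < T)
    {δ κ η : ℝ} (hδ : 0 < δ) (hκ : 0 < κ) (hη : 0 < η) :
    ∃ σ > 0, ∀ x y, κ * ‖x‖ ^ 2 ≤ Real.log M - Real.log ε →
      Real.log (w y 0) - 1 / (1 + δ) * Real.log (w x 0) - 1 / (2 * δ) * ‖x - y‖ ^ 2 / σ ≤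
        δ / (1 + δ) * Real.log M + η := by
  have h0 : (0 : ℝ) ∈ Icc 0 T := ⟨le_rfl, hT.le⟩
  set B := Real.log M - Real.log ε with hB
  have hpos : ∀ x, 0 < w x 0 := fun x => hε.trans_le (hw.le x 0 h0)
  have hlow : ∀ x, Real.log ε ≤ Real.log (w x 0) := fun x => Real.log_le_log hε (hw.le x 0 h0)
  have hup : ∀ x, Real.log (w x 0) ≤ Real.log M := fun x =>
    Real.log_le_log (hpos x) (hw.ge x 0 h0)
  have hB0 : 0 ≤ B := sub_nonneg.2 ((hlow 0).trans (hup 0))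
  have ha : 1 / (1 + δ) = 1 - δ / (1 + δ) := by
    field_simp
    ring
  have hq : 0 ≤ δ / (1 + δ) := by positivity
  have hcont : Continuous fun x => Real.log (w x 0) :=
    (hw.contDiff 0 h0).continuous.log fun x => (hpos x).ne'
  have hunif := (isCompact_closedBall (0 : EuclideanSpace ℝ (Fin n))
    √(B / κ)).uniformContinuousAt_of_continuousAt _ (fun x _ => hcont.continuousAt)
    (Metric.dist_mem_uniformity hη)
  obtain ⟨ρ, hρ, hball⟩ := Metric.mem_uniformity_dist.1 hunif
  refine ⟨ρ ^ 2 / (2 * δ * (B + 1)), by positivity, fun x y hx => ?_⟩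
  have hxup := mul_le_mul_of_nonneg_left (hup x) hq
  rw [ha]
  by_cases hxy : dist x y < ρ
  · have hmem : x ∈ Metric.closedBall (0 : EuclideanSpace ℝ (Fin n)) √(B / κ) :=
      mem_closedBall_zero_iff.2 (Real.le_sqrt_of_sq_le (by rwa [le_div_iff₀' hκ]))
    have hclose := hball hxy hmem
    rw [mem_ofPred_eq, dist_comm, Real.dist_eq] at hclose
    have h₁ := (abs_lt.1 hclose).2
    have h₂ : 0 ≤ 1 / (2 * δ) * ‖x - y‖ ^ 2 / (ρ ^ 2 / (2 * δ * (B + 1))) := by positivity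
    linarith
  · rw [not_lt, dist_eq_norm] at hxy
    have h₂ : B + 1 ≤ 1 / (2 * δ) * ‖x - y‖ ^ 2 / (ρ ^ 2 / (2 * δ * (B + 1))) := by
      have : 1 / (2 * δ) * ‖x - y‖ ^ 2 / (ρ ^ 2 / (2 * δ * (B + 1))) =
          (B + 1) * (‖x - y‖ ^ 2 / ρ ^ 2) := by
        field_simp
      rw [this]
      refine le_mul_of_one_le_right (by linarith) ?_
      rw [one_le_div (by positivity)]
      gcongr
    linarith [hlow x, hup y]

theorem log_le (hw : IsBoundedHeatSolution w T ε M) (hε : 0 < ε) {δ : ℝ} (hδ : 0 < δ)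
    (x y : EuclideanSpace ℝ (Fin n)) {t : ℝ} (ht : t ∈ Ioc 0 T) :
    Real.log (w y t) ≤ 1 / (1 + δ) * Real.log (w x t) + δ / (1 + δ) * Real.log M +
      1 / (2 * δ) * ‖x - y‖ ^ 2 / t := by
  have hT : 0 < T := ht.1.trans_le ht.2
  have h0 : (0 : ℝ) ∈ Icc 0 T := ⟨le_rfl, hT.le⟩
  set B := Real.log M - Real.log ε with hB
  have hB0 : 0 ≤ B := sub_nonneg.2
    (Real.log_le_log hε ((hw.le 0 0 h0).trans (hw.ge 0 0 h0)))
  set C := 2 * n + 8 * (1 + δ) ^ 2 / δ * B + 1 with hC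
  have hC0 : 0 < C := by positivity
  have key : ∀ κ > 0, Real.log (w y t) ≤ 1 / (1 + δ) * Real.log (w x t) +
      δ / (1 + δ) * Real.log M + 1 / (2 * δ) * ‖x - y‖ ^ 2 / t +
      κ * (1 + ‖x‖ ^ 2 + C * t) := by
    intro κ hκ
    obtain ⟨σ, hσ, hinit⟩ := hw.exists_initial_bound hε hT hδ hκ hκ
    obtain ⟨x₀, y₀, t₀, ht₀, hx₀, hmax⟩ := hw.exists_max hε hT (l := κ * C) hδ hκ hσ
      (by positivity)
    have hl : 2 * n * κ + 8 * (1 + δ) ^ 2 / δ * κ ^ 2 * ‖x₀‖ ^ 2 < κ * C := by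
      have : 8 * (1 + δ) ^ 2 / δ * κ * (κ * ‖x₀‖ ^ 2) ≤ 8 * (1 + δ) ^ 2 / δ * κ * B := by
        gcongr
      rw [hC]
      nlinarith
    obtain rfl := hw.time_eq_zero_of_max hε hδ hσ ht₀ hl hmax
    have h₁ := hmax x y t (Ioc_subset_Icc_self ht)
    have h₂ := hinit x₀ y₀ hx₀
    have h₃ : 1 / (2 * δ) * ‖x - y‖ ^ 2 / (t + σ) ≤ 1 / (2 * δ) * ‖x - y‖ ^ 2 / t :=
      div_le_div_of_nonneg_left (by positivity) ht.1 (by linarith)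
    have h₄ : 0 ≤ κ * ‖x₀‖ ^ 2 := by positivity
    rw [zero_add] at h₁
    linarith
  have hD : 0 < 1 + ‖x‖ ^ 2 + C * t := by
    have := ht.1
    positivity
  refine le_of_forall_pos_le_add fun r hr => ?_
  have := key (r / (1 + ‖x‖ ^ 2 + C * t)) (by positivity)
  rwa [div_mul_cancel₀ _ hD.ne'] at this

theorem le_rpow_mul_exp (hw : IsBoundedHeatSolution w T ε M) (hε : 0 < ε) {δ : ℝ} (hδ : 0 < δ)
    (x y : EuclideanSpace ℝ (Fin n)) {t : ℝ} (ht : t ∈ Ioc 0 T) :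
    w y t ≤ w x t ^ (1 / (1 + δ)) * M ^ (δ / (1 + δ)) *
      Real.exp (1 / (2 * δ) * ‖x - y‖ ^ 2 / t) := by
  have ht' := Ioc_subset_Icc_self ht
  have hpos : ∀ z, 0 < w z t := fun z => hε.trans_le (hw.le z t ht')
  have hM : 0 < M := (hpos x).trans_le (hw.ge x t ht')
  rw [← Real.log_le_log_iff (hpos y) (by have := hpos x; positivity),
    Real.log_mul (by have := hpos x; positivity) (Real.exp_pos _).ne',
    Real.log_mul (Real.rpow_pos_of_pos (hpos x) _).ne' (Real.rpow_pos_of_pos hM _).ne',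
    Real.log_rpow (hpos x), Real.log_rpow hM, Real.log_exp]
  exact hw.log_le hε hδ x y ht

/-- Adding a positive constant to a positive smooth bounded solution bounds it away from zero. -/
theorem of_contDiffOn {u : EuclideanSpace ℝ (Fin n) → ℝ → ℝ}
    (hu : ContDiffOn ℝ (⊤ : ℕ∞) (fun p : EuclideanSpace ℝ (Fin n) × ℝ => u p.1 p.2)
      (univ ×ˢ Icc 0 T))
    (hpos : ∀ x, ∀ t ∈ Icc (0 : ℝ) T, 0 < u x t)
    (hle : ∀ x, ∀ t ∈ Icc (0 : ℝ) T, u x t ≤ M)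
    (heat : ∀ x, ∀ t ∈ Icc (0 : ℝ) T,
      derivWithin (fun s => u x s) (Icc 0 T) t = lap (fun y => u y t) x) (ε : ℝ) :
    IsBoundedHeatSolution (fun x t => u x t + ε) T ε (M + ε) where
  continuousOn := hu.continuousOn.add continuousOn_const
  contDiff t ht := by
    have h : ContDiff ℝ (⊤ : ℕ∞) fun x => u x t :=
      contDiffOn_univ.1 (hu.comp (f := fun x => (x, t)) (by fun_prop)
        fun x _ => ⟨mem_univ _, ht⟩)
    exact (contDiff_infty.1 h 2).add contDiff_const
  hasDerivWithinAt x t ht := by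
    have h : ContDiffOn ℝ (⊤ : ℕ∞) (fun s => u x s) (Icc 0 T) :=
      hu.comp (f := fun s => (x, s)) (by fun_prop) fun s hs => ⟨mem_univ _, hs⟩
    have hd := (h.differentiableOn (by simp) t ht).hasDerivWithinAt
    rw [heat x t ht] at hd
    have hlap : lap (fun y => u y t + ε) x = lap (fun y => u y t) x := by
      simp only [lap, fderiv_add_const]
    rw [hlap]
    exact hd.add_const ε
  le x t ht := by linarith [hpos x t ht]
  ge x t ht := by linarith [hle x t ht]

end IsBoundedHeatSolution

/-- The interpolation inequality of Theorem 4.1(ii) (static flat case): for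
every `δ > 0` there exist `c₁, c₂ > 0` depending only on `δ` such that every
positive solution `0 < u ≤ M` of the heat equation on ℝⁿ × [0,T] satisfies
`u(y,t) ≤ c₁ u(x,t)^{1/(1+δ)} M^{δ/(1+δ)} e^{c₂‖x−y‖²/t}`. -/
theorem heat_interpolation_inequality (δ : ℝ) (hδ : 0 < δ) :
    ∃ c₁ > (0 : ℝ), ∃ c₂ > (0 : ℝ),
      ∀ (n : ℕ), 1 ≤ n → ∀ (T M : ℝ), 0 < T → 0 < M →
        ∀ u : EuclideanSpace ℝ (Fin n) → ℝ → ℝ,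
          ContDiffOn ℝ (⊤ : ℕ∞)
            (fun p : EuclideanSpace ℝ (Fin n) × ℝ => u p.1 p.2)
            (univ ×ˢ Icc 0 T) →
          (∀ x, ∀ t ∈ Icc (0 : ℝ) T, 0 < u x t) →
          (∀ x, ∀ t ∈ Icc (0 : ℝ) T, u x t ≤ M) →
          (∀ x, ∀ t ∈ Icc (0 : ℝ) T,
            derivWithin (fun s => u x s) (Icc 0 T) t = lap (fun y => u y t) x) →
          ∀ x y : EuclideanSpace ℝ (Fin n), ∀ t ∈ Ioc (0 : ℝ) T,
            u y t ≤ c₁ * u x t ^ ((1 : ℝ) / (1 + δ)) * M ^ (δ / (1 + δ))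
              * Real.exp (c₂ * ‖x - y‖ ^ 2 / t) := by
  refine ⟨1, one_pos, 1 / (2 * δ), by positivity, ?_⟩
  intro n _ T M hT hM u hu hpos hle heat x y t ht
  have hx := hpos x t (Ioc_subset_Icc_self ht)
  have hlim : Filter.Tendsto (fun ε : ℝ => (u x t + ε) ^ ((1 : ℝ) / (1 + δ)) *
      (M + ε) ^ (δ / (1 + δ)) * Real.exp (1 / (2 * δ) * ‖x - y‖ ^ 2 / t)) (nhdsWithin 0 (Ioi 0))
      (nhds (u x t ^ ((1 : ℝ) / (1 + δ)) * M ^ (δ / (1 + δ)) *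
        Real.exp (1 / (2 * δ) * ‖x - y‖ ^ 2 / t))) := by
    have hc : ContinuousAt (fun ε : ℝ => (u x t + ε) ^ ((1 : ℝ) / (1 + δ)) *
        (M + ε) ^ (δ / (1 + δ)) * Real.exp (1 / (2 * δ) * ‖x - y‖ ^ 2 / t)) 0 :=
      (((continuousAt_const.add continuousAt_id).rpow_const (Or.inl (by simpa using hx.ne'))).mul
        ((continuousAt_const.add continuousAt_id).rpow_const
          (Or.inl (by simpa using hM.ne')))).mul continuousAt_const
    simpa using hc.tendsto.mono_left nhdsWithin_le_nhds
  rw [one_mul]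
  refine ge_of_tendsto hlim ?_
  filter_upwards [self_mem_nhdsWithin] with ε hε
  exact (le_add_of_nonneg_right (le_of_lt hε)).trans
    ((IsBoundedHeatSolution.of_contDiffOn hu hpos hle heat ε).le_rpow_mul_exp hε hδ x y ht)
end

section
/- Let n ≥ 1, x₀ ∈ ℝⁿ, λ ≤ 0, τ > 0, and let f : ℝⁿ → ℝ be a continuous function with compact support. Define u(x) = ∫_{ℝⁿ} (4πτ)^{−n/2} · exp(−‖x − y‖²/(4τ)) · exp(−λ‖y − x₀‖) · f(y) dy. Then ∫_{ℝⁿ} exp(2λ‖x − x₀‖) · u(x)² dx ≤ exp(2λ²τ) · ∫_{ℝⁿ} f(y)² dy. -/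
open MeasureTheory

/-- The weight `exp (2 lam √(‖x - x₀‖² + ε²))`, a smooth version of `exp (2 lam ‖x - x₀‖)`. -/
noncomputable def smoothWeight {F : Type*} [NormedAddCommGroup F] (x₀ : F) (lam ε : ℝ)
    (x : F) : ENNReal :=
  ENNReal.ofReal (Real.exp (2 * lam * √(‖x - x₀‖ ^ 2 + ε ^ 2)))

@[fun_prop]
lemma measurable_smoothWeight {F : Type*} [NormedAddCommGroup F] [MeasurableSpace F]
    [BorelSpace F] (x₀ : F) (lam ε : ℝ) : Measurable (smoothWeight x₀ lam ε) := by
  unfold smoothWeight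
  fun_prop

lemma sq_lintegral_le_lintegral_exp_mul {α : Type*} [MeasurableSpace α] (μ : Measure α)
    {G : α → ENNReal} {h : α → ℝ} (hG : Measurable G) (hh : Measurable h) :
    (∫⁻ x, G x ∂μ) ^ 2 ≤ (∫⁻ x, ENNReal.ofReal (Real.exp (-h x)) ∂μ) *
      ∫⁻ x, ENNReal.ofReal (Real.exp (h x)) * G x ^ 2 ∂μ := by
  have hCS := ENNReal.lintegral_mul_le_Lp_mul_Lq μ Real.HolderConjugate.two_two
    (f := fun x => ENNReal.ofReal (Real.exp (-h x / 2)))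
    (g := fun x => ENNReal.ofReal (Real.exp (h x / 2)) * G x) (by fun_prop) (by fun_prop)
  have e1 : ∀ x, ENNReal.ofReal (Real.exp (-h x / 2)) * (ENNReal.ofReal (Real.exp (h x / 2)) * G x)
      = G x := fun x => by
    rw [← mul_assoc, ← ENNReal.ofReal_mul (by positivity), ← Real.exp_add]
    ring_nf
    simp
  have e2 : ∀ r : ℝ, ENNReal.ofReal (Real.exp (r / 2)) ^ 2 = ENNReal.ofReal (Real.exp r) := by
    intro r
    rw [← ENNReal.ofReal_pow (by positivity), ← Real.exp_nat_mul]
    congr 2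
    push_cast
    ring
  simp only [Pi.mul_apply, e1, ENNReal.rpow_two, mul_pow, e2] at hCS
  have key : ∀ a : ENNReal, (a ^ (1 / 2 : ℝ)) ^ 2 = a := fun a => by
    rw [← ENNReal.rpow_two, ← ENNReal.rpow_mul]; norm_num
  calc _ ≤ _ := pow_le_pow_left' hCS 2
    _ = _ := by rw [mul_pow, key, key]

lemma exp_sub_le (a t : ℝ) : Real.exp (a - t) ≤ Real.exp a + |t| * Real.exp (a - t) := by
  have h1 : Real.exp a = Real.exp (a - t) * Real.exp t := by
    rw [← Real.exp_add, sub_add_cancel]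
  have h2 := mul_le_mul_of_nonneg_left
    (show 1 - |t| ≤ Real.exp t by linarith [Real.add_one_le_exp t, neg_abs_le t])
    (Real.exp_pos (a - t)).le
  linarith

/-- The error of the trapezoid rule for `√(‖·‖² + ε²)` along the segment from `b` to `b - y`. -/
lemma exp_trapezoid_sqrt_le {F : Type*} [NormedAddCommGroup F] [InnerProductSpace ℝ F] {ε : ℝ}
    (hε : 0 < ε) (lam : ℝ) (b y : F) :
    Real.exp (2 * lam * (√(‖b - y‖ ^ 2 + ε ^ 2) - √(‖b‖ ^ 2 + ε ^ 2))
        + lam * inner ℝ (b - y) y / √(‖b - y‖ ^ 2 + ε ^ 2))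
      ≤ Real.exp (-(lam * inner ℝ b y / √(‖b‖ ^ 2 + ε ^ 2)))
        + |lam| / (2 * ε ^ 2) * (‖y‖ ^ 3 * Real.exp (5 * |lam| * ‖y‖)) := by
  set R := √(‖b - y‖ ^ 2 + ε ^ 2) with hR
  set S := √(‖b‖ ^ 2 + ε ^ 2) with hS
  have hR2 : R ^ 2 = ‖b - y‖ ^ 2 + ε ^ 2 := Real.sq_sqrt (by positivity)
  have hS2 : S ^ 2 = ‖b‖ ^ 2 + ε ^ 2 := Real.sq_sqrt (by positivity)
  have hRε : ε ≤ R := Real.le_sqrt_of_sq_le (by nlinarith [sq_nonneg ‖b - y‖])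
  have hSε : ε ≤ S := Real.le_sqrt_of_sq_le (by nlinarith [sq_nonneg ‖b‖])
  have hR0 : 0 < R := hε.trans_le hRε
  have hS0 : 0 < S := hε.trans_le hSε
  have hy := norm_nonneg y
  have hRb : ‖b - y‖ ≤ R := Real.le_sqrt_of_sq_le (by nlinarith)
  have hSb : ‖b‖ ≤ S := Real.le_sqrt_of_sq_le (by nlinarith)
  have hsub : ‖b - y‖ ^ 2 = ‖b‖ ^ 2 - 2 * inner ℝ b y + ‖y‖ ^ 2 := norm_sub_sq_real b y
  have hp : inner ℝ b y = (S ^ 2 - R ^ 2 + ‖y‖ ^ 2) / 2 := by rw [hR2, hS2]; linarith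
  have hq : inner ℝ (b - y) y = (S ^ 2 - R ^ 2 - ‖y‖ ^ 2) / 2 := by
    rw [inner_sub_left, real_inner_self_eq_norm_sq, hp]; ring
  have hpb : |inner ℝ b y| ≤ S * ‖y‖ :=
    (abs_real_inner_le_norm b y).trans (by gcongr)
  have hqb : |inner ℝ (b - y) y| ≤ R * ‖y‖ :=
    (abs_real_inner_le_norm _ y).trans (by gcongr)
  have hRS : |R - S| ≤ ‖y‖ := by
    rw [abs_le]
    constructor
    · nlinarith [(abs_le.mp hqb).1, (abs_le.mp hqb).2]
    · nlinarith [(abs_le.mp hpb).1, (abs_le.mp hpb).2]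
  set A := -(lam * inner ℝ b y / S) with hA
  set D := (R - S) * ((R - S) ^ 2 - ‖y‖ ^ 2) / (2 * R * S) with hD
  have hexp : 2 * lam * (R - S) + lam * inner ℝ (b - y) y / R = A - lam * D := by
    rw [hA, hD, hp, hq]
    field_simp
    ring
  have hDb : |D| ≤ ‖y‖ ^ 3 / (2 * ε ^ 2) := by
    have h1 : |(R - S) ^ 2 - ‖y‖ ^ 2| ≤ ‖y‖ ^ 2 := by
      have := sq_le_sq' (abs_le.mp hRS).1 (abs_le.mp hRS).2
      rw [abs_le]
      constructor <;> nlinarith [sq_nonneg (R - S)]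
    rw [hD, abs_div, abs_mul, abs_of_pos (by positivity : 0 < 2 * R * S)]
    calc _ ≤ ‖y‖ * ‖y‖ ^ 2 / (2 * ε * ε) := by gcongr
      _ = _ := by ring
  have hAb : |A| ≤ |lam| * ‖y‖ := by
    rw [hA, abs_neg, abs_div, abs_mul, abs_of_pos hS0, div_le_iff₀ hS0]
    nlinarith [abs_nonneg lam]
  have hEb : |A - lam * D| ≤ 3 * |lam| * ‖y‖ := by
    rw [← hexp]
    refine (abs_add_le _ _).trans ?_
    have h1 : |2 * lam * (R - S)| ≤ 2 * |lam| * ‖y‖ := by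
      rw [abs_mul, abs_mul, abs_two]; gcongr
    have h2 : |lam * inner ℝ (b - y) y / R| ≤ |lam| * ‖y‖ := by
      rw [abs_div, abs_mul, abs_of_pos hR0, div_le_iff₀ hR0]
      nlinarith [abs_nonneg lam]
    linarith
  rw [hexp]
  have hle : A - lam * D ≤ 5 * |lam| * ‖y‖ := by
    have := (abs_le.mp hEb).2
    have : 0 ≤ |lam| * ‖y‖ := by positivity
    linarith
  have hmv := exp_sub_le A (lam * D)
  have hfin : |lam * D| * Real.exp (A - lam * D)
      ≤ |lam| / (2 * ε ^ 2) * (‖y‖ ^ 3 * Real.exp (5 * |lam| * ‖y‖)) := by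
    rw [abs_mul]
    calc _ ≤ |lam| * (‖y‖ ^ 3 / (2 * ε ^ 2)) * Real.exp (5 * |lam| * ‖y‖) := by gcongr
      _ = _ := by ring
  linarith

section HeatMeasure

variable {E : Type*} [NormedAddCommGroup E] [InnerProductSpace ℝ E] [FiniteDimensional ℝ E]
  [MeasurableSpace E] [BorelSpace E]

variable (E) in
/-- The heat kernel measure at time `s`: the law of `√(2s) Z` for a standard Gaussian `Z`. -/
noncomputable def heatMeasure (s : ℝ) : Measure E :=
  (ProbabilityTheory.stdGaussian E).map (fun z => √(2 * s) • z)

instance isProbabilityMeasure_heatMeasure (s : ℝ) : IsProbabilityMeasure (heatMeasure E s) :=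
  Measure.isProbabilityMeasure_map (by fun_prop)

lemma charFun_heatMeasure {s : ℝ} (hs : 0 ≤ s) (t : E) :
    charFun (heatMeasure E s) t = Complex.exp (-s * ‖t‖ ^ 2) := by
  rw [heatMeasure, charFun_map_smul, ProbabilityTheory.charFun_stdGaussian]
  congr 1
  have h : ‖√(2 * s) • t‖ ^ 2 = 2 * s * ‖t‖ ^ 2 := by
    rw [norm_smul, mul_pow, Real.norm_eq_abs, sq_abs, Real.sq_sqrt (by positivity)]
  rw [← Complex.ofReal_pow, h]
  push_cast
  ring

lemma heatMeasure_conv {s t : ℝ} (hs : 0 ≤ s) (ht : 0 ≤ t) :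
    (heatMeasure E s).conv (heatMeasure E t) = heatMeasure E (s + t) := by
  refine Measure.ext_of_charFun (funext fun x => ?_)
  rw [charFun_conv, charFun_heatMeasure hs, charFun_heatMeasure ht,
    charFun_heatMeasure (add_nonneg hs ht), ← Complex.exp_add]
  congr 1
  push_cast
  ring

lemma heatMeasure_eq_withDensity {s : ℝ} (hs : 0 < s) :
    heatMeasure E s = volume.withDensity fun y => ENNReal.ofReal
      ((4 * Real.pi * s) ^ (-(Module.finrank ℝ E : ℝ) / 2) * Real.exp (-‖y‖ ^ 2 / (4 * s))) := by
  have hpi := Real.pi_pos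
  have hb : 0 < ((1 / (4 * s) : ℝ) : ℂ).re := by
    rw [Complex.ofReal_re]; positivity
  have hint : Integrable (fun y : E =>
      (4 * Real.pi * s) ^ (-(Module.finrank ℝ E : ℝ) / 2) * Real.exp (-‖y‖ ^ 2 / (4 * s))) := by
    refine Integrable.const_mul ?_ _
    have h := (GaussianFourier.integrable_cexp_neg_mul_sq_norm_add (V := E) hb 0 0).norm
    refine h.congr (ae_of_all _ fun y => ?_)
    simp only [Complex.norm_exp, zero_mul, add_zero]
    rw [← Complex.ofReal_pow, ← Complex.ofReal_neg, ← Complex.ofReal_mul, Complex.ofReal_re]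
    congr 1
    ring
  have : IsFiniteMeasure (volume.withDensity fun y : E => ENNReal.ofReal
      ((4 * Real.pi * s) ^ (-(Module.finrank ℝ E : ℝ) / 2) * Real.exp (-‖y‖ ^ 2 / (4 * s)))) :=
    isFiniteMeasure_withDensity_ofReal hint.2
  refine Measure.ext_of_charFun (funext fun t => ?_)
  rw [charFun_heatMeasure hs.le, charFun_apply,
    integral_withDensity_eq_integral_toReal_smul (by fun_prop) (by simp)]
  have h := GaussianFourier.integral_cexp_neg_mul_sq_norm_add (V := E) hb Complex.I t
  have h2 : ∀ y : E, (ENNReal.ofReal ((4 * Real.pi * s) ^ (-(Module.finrank ℝ E : ℝ) / 2)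
      * Real.exp (-‖y‖ ^ 2 / (4 * s)))).toReal • Complex.exp (inner ℝ y t * Complex.I)
      = (((4 * Real.pi * s) ^ (-(Module.finrank ℝ E : ℝ) / 2) : ℝ) : ℂ) *
        Complex.exp (-((1 / (4 * s) : ℝ) : ℂ) * ‖y‖ ^ 2 + Complex.I * inner ℝ t y) := by
    intro y
    rw [ENNReal.toReal_ofReal (by positivity), Complex.real_smul, Complex.ofReal_mul, mul_assoc,
      Complex.ofReal_exp, ← Complex.exp_add, real_inner_comm]
    congr 2
    push_cast
    ring
  simp_rw [h2]
  rw [integral_const_mul, h]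
  have h3 : ((Real.pi : ℂ) / ((1 / (4 * s) : ℝ) : ℂ)) ^ (Module.finrank ℝ E / 2 : ℂ)
      = (((4 * Real.pi * s) ^ ((Module.finrank ℝ E : ℝ) / 2) : ℝ) : ℂ) := by
    rw [Complex.ofReal_cpow (by positivity)]
    congr 1
    · push_cast; field_simp
    · push_cast; rfl
  rw [h3, ← mul_assoc, ← Complex.ofReal_mul, ← Real.rpow_add (by positivity)]
  have h4 : -(Module.finrank ℝ E : ℝ) / 2 + (Module.finrank ℝ E : ℝ) / 2 = 0 := by ring
  rw [h4, Real.rpow_zero, Complex.ofReal_one, one_mul, Complex.I_sq]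
  congr 1
  have : (s : ℂ) ≠ 0 := by exact_mod_cast hs.ne'
  push_cast
  field_simp

lemma lintegral_exp_inner_heatMeasure {s : ℝ} (hs : 0 ≤ s) (v : E) :
    ∫⁻ y, ENNReal.ofReal (Real.exp (inner ℝ v y)) ∂(heatMeasure E s)
      = ENNReal.ofReal (Real.exp (s * ‖v‖ ^ 2)) := by
  have hmap := ProbabilityTheory.IsGaussian.map_eq_gaussianReal
    (μ := ProbabilityTheory.stdGaussian E) (innerSL ℝ v)
  rw [ProbabilityTheory.integral_strongDual_stdGaussian,
    ProbabilityTheory.variance_dual_stdGaussian, innerSL_apply_norm] at hmap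
  have hmap' : (ProbabilityTheory.stdGaussian E).map (fun y => inner ℝ v y)
      = ProbabilityTheory.gaussianReal 0 (‖v‖ ^ 2).toNNReal := hmap
  rw [heatMeasure, lintegral_map (by fun_prop) (by fun_prop)]
  simp_rw [inner_smul_right]
  rw [← lintegral_map (f := fun r : ℝ => ENNReal.ofReal (Real.exp (√(2 * s) * r)))
    (g := fun y : E => inner ℝ v y) (by fun_prop) (by fun_prop), hmap',
    ← ofReal_integral_eq_lintegral_ofReal
      (ProbabilityTheory.integrable_exp_mul_gaussianReal _)
      (ae_of_all _ fun _ => (Real.exp_pos _).le)]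
  have h := congrFun (ProbabilityTheory.mgf_fun_id_gaussianReal (μ := 0)
    (v := (‖v‖ ^ 2).toNNReal)) (√(2 * s))
  rw [ProbabilityTheory.mgf] at h
  rw [h, Real.sq_sqrt (by positivity), Real.coe_toNNReal _ (by positivity)]
  congr 2
  ring

lemma exists_lintegral_cube_mul_exp_heatMeasure_le {c : ℝ} (hc : 0 ≤ c) :
    ∃ K : ℝ, 0 ≤ K ∧ ∀ s : ℝ, 0 ≤ s → s ≤ 1 →
      ∫⁻ y, ENNReal.ofReal (‖y‖ ^ 3 * Real.exp (c * ‖y‖)) ∂(heatMeasure E s)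
        ≤ ENNReal.ofReal (K * √s ^ 3) := by
  obtain ⟨C, hC, hint⟩ := ProbabilityTheory.IsGaussian.exists_integrable_exp_sq
    (ProbabilityTheory.stdGaussian E)
  set d := √2 * c + 1 with hd
  have hint2 : Integrable (fun z : E => √2 ^ 3 * (6 * Real.exp (d ^ 2 / (4 * C))) *
      Real.exp (C * ‖z‖ ^ 2)) (ProbabilityTheory.stdGaussian E) := hint.const_mul _
  refine ⟨∫ z : E, √2 ^ 3 * (6 * Real.exp (d ^ 2 / (4 * C))) * Real.exp (C * ‖z‖ ^ 2)
    ∂(ProbabilityTheory.stdGaussian E), integral_nonneg fun z => by positivity,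
    fun s hs0 hs1 => ?_⟩
  rw [← integral_mul_const, ofReal_integral_eq_lintegral_ofReal (hint2.mul_const _)
    (ae_of_all _ fun z => by positivity), heatMeasure, lintegral_map (by fun_prop) (by fun_prop)]
  refine lintegral_mono fun z => ENNReal.ofReal_le_ofReal ?_
  have hz := norm_nonneg z
  have hs : √s ≤ 1 := Real.sqrt_le_one.mpr hs1
  rw [norm_smul, Real.norm_of_nonneg (Real.sqrt_nonneg _), Real.sqrt_mul (by norm_num)]
  have h3 : ‖z‖ ^ 3 ≤ 6 * Real.exp ‖z‖ := by
    have := Real.pow_div_factorial_le_exp ‖z‖ hz 3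
    norm_num [Nat.factorial] at this
    linarith
  have he : c * (√2 * √s * ‖z‖) ≤ √2 * c * ‖z‖ := by
    have : 0 ≤ √2 * c * ‖z‖ := by positivity
    nlinarith
  have hq : d * ‖z‖ ≤ d ^ 2 / (4 * C) + C * ‖z‖ ^ 2 := by
    have : d ^ 2 / (4 * C) + C * ‖z‖ ^ 2 - d * ‖z‖ = (d - 2 * C * ‖z‖) ^ 2 / (4 * C) := by
      field_simp; ring
    have : 0 ≤ (d - 2 * C * ‖z‖) ^ 2 / (4 * C) := by positivity
    linarith
  calc (√2 * √s * ‖z‖) ^ 3 * Real.exp (c * (√2 * √s * ‖z‖))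
      ≤ (√2 * √s) ^ 3 * (6 * Real.exp ‖z‖) * Real.exp (√2 * c * ‖z‖) := by
        rw [mul_pow _ ‖z‖]; gcongr
    _ = (√2 * √s) ^ 3 * 6 * Real.exp (d * ‖z‖) := by
        rw [show d * ‖z‖ = ‖z‖ + √2 * c * ‖z‖ by rw [hd]; ring, Real.exp_add]; ring
    _ ≤ (√2 * √s) ^ 3 * 6 * Real.exp (d ^ 2 / (4 * C) + C * ‖z‖ ^ 2) := by gcongr
    _ = _ := by rw [Real.exp_add]; ring

@[fun_prop]
lemma measurable_lintegral_add_heatMeasure (s : ℝ) {G : E → ENNReal} (hG : Measurable G) :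
    Measurable fun x => ∫⁻ y, G (x + y) ∂(heatMeasure E s) :=
  Measurable.lintegral_prod_right' (f := fun p : E × E => G (p.1 + p.2)) (by fun_prop)

lemma exists_lintegral_smoothWeight_le (x₀ : E) (lam : ℝ) {ε : ℝ} (hε : 0 < ε) :
    ∃ C : ℝ, 0 ≤ C ∧ ∀ s : ℝ, 0 ≤ s → s ≤ 1 → ∀ G : E → ENNReal, Measurable G →
      ∫⁻ x, smoothWeight x₀ lam ε x * (∫⁻ y, G (x + y) ∂(heatMeasure E s)) ^ 2
        ≤ ENNReal.ofReal (Real.exp (2 * lam ^ 2 * s + C * √s ^ 3)) *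
          ∫⁻ x, smoothWeight x₀ lam ε x * G x ^ 2 := by
  obtain ⟨K, hK, hKs⟩ := exists_lintegral_cube_mul_exp_heatMeasure_le (E := E)
    (c := 5 * |lam|) (by positivity)
  refine ⟨|lam| / (2 * ε ^ 2) * K, by positivity, fun s hs0 hs1 G hG => ?_⟩
  set C := |lam| / (2 * ε ^ 2) * K with hC
  set N : E → ℝ := fun x => √(‖x - x₀‖ ^ 2 + ε ^ 2) with hN
  have hN0 : ∀ x, 0 < N x := fun x => by positivity
  have hNx : ∀ x, ‖x - x₀‖ ≤ N x := fun x => Real.le_sqrt_of_sq_le (by nlinarith)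
  have hgrad : ∀ x, ∫⁻ y, ENNReal.ofReal (Real.exp (-(lam * inner ℝ (x - x₀) y / N x)))
      ∂(heatMeasure E s) ≤ ENNReal.ofReal (Real.exp (lam ^ 2 * s)) := by
    intro x
    have h := lintegral_exp_inner_heatMeasure hs0 ((-(lam / N x)) • (x - x₀))
    have e : ∀ y, inner ℝ ((-(lam / N x)) • (x - x₀)) y = -(lam * inner ℝ (x - x₀) y / N x) := by
      intro y; rw [real_inner_smul_left]; ring
    simp_rw [e] at h
    rw [h]
    refine ENNReal.ofReal_le_ofReal (Real.exp_le_exp.mpr ?_)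
    have h1 : ‖(-(lam / N x)) • (x - x₀)‖ ≤ |lam| := by
      rw [norm_smul, Real.norm_eq_abs, abs_neg, abs_div, abs_of_pos (hN0 x), div_mul_eq_mul_div,
        div_le_iff₀ (hN0 x)]
      exact mul_le_mul_of_nonneg_left (hNx x) (abs_nonneg _)
    have h2 : ‖(-(lam / N x)) • (x - x₀)‖ ^ 2 ≤ lam ^ 2 := by
      rw [← sq_abs lam]; gcongr
    nlinarith
  have hback : ∀ x, ∫⁻ y, smoothWeight x₀ lam ε (x - y) *
      ENNReal.ofReal (Real.exp (lam * inner ℝ (x - y - x₀) y / N (x - y))) ∂(heatMeasure E s)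
      ≤ smoothWeight x₀ lam ε x * ENNReal.ofReal (Real.exp (lam ^ 2 * s + C * √s ^ 3)) := by
    intro x
    calc _ ≤ ∫⁻ y, smoothWeight x₀ lam ε x *
          (ENNReal.ofReal (Real.exp (-(lam * inner ℝ (x - x₀) y / N x)))
            + ENNReal.ofReal (|lam| / (2 * ε ^ 2)) *
              ENNReal.ofReal (‖y‖ ^ 3 * Real.exp (5 * |lam| * ‖y‖))) ∂(heatMeasure E s) := by
          refine lintegral_mono fun y => ?_
          have h := exp_trapezoid_sqrt_le hε lam (x - x₀) y
          rw [show x - x₀ - y = x - y - x₀ by abel] at h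
          simp only [smoothWeight]
          rw [← ENNReal.ofReal_mul (by positivity), ← ENNReal.ofReal_mul (by positivity),
            ← ENNReal.ofReal_add (by positivity) (by positivity),
            ← ENNReal.ofReal_mul (by positivity)]
          refine ENNReal.ofReal_le_ofReal ?_
          refine le_trans (le_of_eq ?_) (mul_le_mul_of_nonneg_left h (Real.exp_pos _).le)
          rw [← Real.exp_add, ← Real.exp_add]
          congr 1
          simp only [hN]
          ring
      _ = smoothWeight x₀ lam ε x *
          (∫⁻ y, ENNReal.ofReal (Real.exp (-(lam * inner ℝ (x - x₀) y / N x))) ∂(heatMeasure E s)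
            + ENNReal.ofReal (|lam| / (2 * ε ^ 2)) *
              ∫⁻ y, ENNReal.ofReal (‖y‖ ^ 3 * Real.exp (5 * |lam| * ‖y‖)) ∂(heatMeasure E s)) := by
          rw [lintegral_const_mul _ (by fun_prop), lintegral_add_left (by fun_prop),
            lintegral_const_mul _ (by fun_prop)]
      _ ≤ smoothWeight x₀ lam ε x * (ENNReal.ofReal (Real.exp (lam ^ 2 * s)) +
            ENNReal.ofReal (|lam| / (2 * ε ^ 2)) * ENNReal.ofReal (K * √s ^ 3)) := by
          gcongr
          · exact hgrad x
          · exact hKs s hs0 hs1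
      _ ≤ _ := by
          rw [← ENNReal.ofReal_mul (by positivity),
            ← ENNReal.ofReal_add (by positivity) (by positivity), ← mul_assoc, ← hC]
          gcongr
          have h1 : 1 ≤ Real.exp (lam ^ 2 * s) := Real.one_le_exp (by positivity)
          have h2 := Real.add_one_le_exp (C * √s ^ 3)
          have h3 : 0 ≤ C * √s ^ 3 := by positivity
          rw [Real.exp_add]
          nlinarith
  have hNm : Measurable N := by fun_prop
  calc _ ≤ ∫⁻ x, smoothWeight x₀ lam ε x * (ENNReal.ofReal (Real.exp (lam ^ 2 * s)) *
        ∫⁻ y, ENNReal.ofReal (Real.exp (lam * inner ℝ (x - x₀) y / N x)) * G (x + y) ^ 2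
          ∂(heatMeasure E s)) := by
        refine lintegral_mono fun x => mul_le_mul_right ?_ _
        refine (sq_lintegral_le_lintegral_exp_mul (heatMeasure E s)
          (h := fun y => lam * inner ℝ (x - x₀) y / N x) (by fun_prop) (by fun_prop)).trans ?_
        exact mul_le_mul_left (hgrad x) _
    _ = ENNReal.ofReal (Real.exp (lam ^ 2 * s)) * ∫⁻ x, ∫⁻ y, smoothWeight x₀ lam ε x *
          ENNReal.ofReal (Real.exp (lam * inner ℝ (x - x₀) y / N x)) * G (x + y) ^ 2
          ∂(heatMeasure E s) := by
        rw [← lintegral_const_mul' _ _ ENNReal.ofReal_ne_top]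
        refine lintegral_congr fun x => ?_
        simp_rw [mul_assoc]
        rw [lintegral_const_mul _ (by fun_prop)]
        ring
    _ = ENNReal.ofReal (Real.exp (lam ^ 2 * s)) * ∫⁻ y, ∫⁻ x, smoothWeight x₀ lam ε x *
          ENNReal.ofReal (Real.exp (lam * inner ℝ (x - x₀) y / N x)) * G (x + y) ^ 2
          ∂volume ∂(heatMeasure E s) := by
        rw [lintegral_lintegral_swap (by fun_prop)]
    _ = ENNReal.ofReal (Real.exp (lam ^ 2 * s)) * ∫⁻ y, ∫⁻ x, smoothWeight x₀ lam ε (x - y) *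
          ENNReal.ofReal (Real.exp (lam * inner ℝ (x - y - x₀) y / N (x - y))) * G x ^ 2
          ∂volume ∂(heatMeasure E s) := by
        congr 1
        refine lintegral_congr fun y => ?_
        rw [← lintegral_sub_right_eq_self _ y]
        simp_rw [sub_add_cancel]
    _ = ENNReal.ofReal (Real.exp (lam ^ 2 * s)) * ∫⁻ x, (∫⁻ y, smoothWeight x₀ lam ε (x - y) *
          ENNReal.ofReal (Real.exp (lam * inner ℝ (x - y - x₀) y / N (x - y)))
          ∂(heatMeasure E s)) * G x ^ 2 := by
        rw [lintegral_lintegral_swap (by fun_prop)]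
        congr 1
        refine lintegral_congr fun x => ?_
        rw [lintegral_mul_const _ (by fun_prop)]
    _ ≤ ENNReal.ofReal (Real.exp (lam ^ 2 * s)) * ∫⁻ x, smoothWeight x₀ lam ε x *
          ENNReal.ofReal (Real.exp (lam ^ 2 * s + C * √s ^ 3)) * G x ^ 2 := by
        gcongr with x
        exact hback x
    _ = _ := by
        have e : ENNReal.ofReal (Real.exp (2 * lam ^ 2 * s + C * √s ^ 3))
            = ENNReal.ofReal (Real.exp (lam ^ 2 * s))
              * ENNReal.ofReal (Real.exp (lam ^ 2 * s + C * √s ^ 3)) := by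
          rw [← ENNReal.ofReal_mul (by positivity), ← Real.exp_add]
          ring_nf
        rw [e, mul_assoc (ENNReal.ofReal (Real.exp (lam ^ 2 * s)))]
        congr 1
        rw [← lintegral_const_mul' _ _ ENNReal.ofReal_ne_top]
        refine lintegral_congr fun x => ?_
        ring

lemma lintegral_add_heatMeasure_add {s t : ℝ} (hs : 0 ≤ s) (ht : 0 ≤ t) {G : E → ENNReal}
    (hG : Measurable G) (x : E) :
    ∫⁻ y, G (x + y) ∂(heatMeasure E (s + t))
      = ∫⁻ y, ∫⁻ z, G (x + y + z) ∂(heatMeasure E t) ∂(heatMeasure E s) := by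
  rw [← heatMeasure_conv hs ht, Measure.lintegral_conv (by fun_prop)]
  simp_rw [add_assoc]

lemma lintegral_smoothWeight_iterate_le {x₀ : E} {lam ε s : ℝ} {A : ENNReal} (hs : 0 ≤ s)
    (hA : ∀ G : E → ENNReal, Measurable G →
      ∫⁻ x, smoothWeight x₀ lam ε x * (∫⁻ y, G (x + y) ∂(heatMeasure E s)) ^ 2
        ≤ A * ∫⁻ x, smoothWeight x₀ lam ε x * G x ^ 2)
    {G : E → ENNReal} (hG : Measurable G) (m : ℕ) :
    ∫⁻ x, smoothWeight x₀ lam ε x * (∫⁻ y, G (x + y) ∂(heatMeasure E (m * s))) ^ 2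
      ≤ A ^ m * ∫⁻ x, smoothWeight x₀ lam ε x * G x ^ 2 := by
  induction m with
  | zero =>
    have h : heatMeasure E 0 = Measure.dirac 0 := by simp [heatMeasure, Measure.map_const]
    simp [h]
  | succ m ih =>
    have e : ((m + 1 : ℕ) : ℝ) * s = s + m * s := by push_cast; ring
    rw [e]
    simp_rw [lintegral_add_heatMeasure_add hs (mul_nonneg m.cast_nonneg hs) hG]
    refine (hA _ (measurable_lintegral_add_heatMeasure _ hG)).trans ?_
    rw [pow_succ', mul_assoc]
    exact mul_le_mul_right ih _

lemma lintegral_smoothWeight_heatMeasure_le (x₀ : E) (lam : ℝ) {ε τ : ℝ} (hε : 0 < ε)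
    (hτ : 0 < τ) {G : E → ENNReal} (hG : Measurable G) :
    ∫⁻ x, smoothWeight x₀ lam ε x * (∫⁻ y, G (x + y) ∂(heatMeasure E τ)) ^ 2
      ≤ ENNReal.ofReal (Real.exp (2 * lam ^ 2 * τ)) *
        ∫⁻ x, smoothWeight x₀ lam ε x * G x ^ 2 := by
  obtain ⟨C, -, hstep⟩ := exists_lintegral_smoothWeight_le x₀ lam hε
  have hdiv : Filter.Tendsto (fun m : ℕ => τ / (m : ℝ)) Filter.atTop (nhds 0) :=
    tendsto_const_div_atTop_nhds_zero_nat τ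
  have hlim : Filter.Tendsto (fun m : ℕ =>
      ENNReal.ofReal (Real.exp (2 * lam ^ 2 * τ + C * (τ * √(τ / m)))) *
        ∫⁻ x, smoothWeight x₀ lam ε x * G x ^ 2) Filter.atTop
      (nhds (ENNReal.ofReal (Real.exp (2 * lam ^ 2 * τ)) *
        ∫⁻ x, smoothWeight x₀ lam ε x * G x ^ 2)) := by
    refine ENNReal.Tendsto.mul_const ?_ (Or.inl ?_)
    · refine ENNReal.tendsto_ofReal ((Real.continuous_exp.tendsto _).comp ?_)
      have h := (((Real.continuous_sqrt.tendsto 0).comp hdiv).const_mul τ).const_mul C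
      simpa using h.const_add (2 * lam ^ 2 * τ)
    · simpa using Real.exp_pos _
  refine ge_of_tendsto hlim ?_
  filter_upwards [Filter.eventually_gt_atTop 0, hdiv.eventually_le_const one_pos] with m hm hm1
  have hm0 : (0 : ℝ) < m := by exact_mod_cast hm
  have hs0 : 0 ≤ τ / m := by positivity
  have h := lintegral_smoothWeight_iterate_le hs0 (hstep (τ / m) hs0 hm1) hG m
  rw [mul_div_cancel₀ _ hm0.ne', ← ENNReal.ofReal_pow (by positivity), ← Real.exp_nat_mul] at h
  have e : (m : ℝ) * (2 * lam ^ 2 * (τ / m) + C * √(τ / m) ^ 3)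
      = 2 * lam ^ 2 * τ + C * (τ * √(τ / m)) := by
    have : √(τ / m) ^ 3 = τ / m * √(τ / m) := by rw [pow_succ, Real.sq_sqrt hs0]
    rw [this]
    field_simp
  rwa [e] at h

/-- Davies' estimate for the heat flow of nonnegative functions, in `ℝ≥0∞`. -/
lemma lintegral_exp_mul_sq_heatMeasure_le (x₀ : E) {lam τ : ℝ} (hlam : lam ≤ 0) (hτ : 0 < τ)
    {G : E → ENNReal} (hG : Measurable G) :
    ∫⁻ x, ENNReal.ofReal (Real.exp (2 * lam * ‖x - x₀‖)) *
        (∫⁻ y, G (x + y) ∂(heatMeasure E τ)) ^ 2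
      ≤ ENNReal.ofReal (Real.exp (2 * lam ^ 2 * τ)) *
        ∫⁻ x, ENNReal.ofReal (Real.exp (2 * lam * ‖x - x₀‖)) * G x ^ 2 := by
  have hlim : Filter.Tendsto (fun ε : ℝ => ENNReal.ofReal (Real.exp (-(2 * lam * ε))) *
      (ENNReal.ofReal (Real.exp (2 * lam ^ 2 * τ)) *
        ∫⁻ x, ENNReal.ofReal (Real.exp (2 * lam * ‖x - x₀‖)) * G x ^ 2)) (nhdsWithin 0 (Set.Ioi 0))
      (nhds (1 * (ENNReal.ofReal (Real.exp (2 * lam ^ 2 * τ)) *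
        ∫⁻ x, ENNReal.ofReal (Real.exp (2 * lam * ‖x - x₀‖)) * G x ^ 2))) := by
    refine ENNReal.Tendsto.mul_const ?_ (Or.inl one_ne_zero)
    have hc : Continuous fun ε : ℝ => ENNReal.ofReal (Real.exp (-(2 * lam * ε))) :=
      ENNReal.continuous_ofReal.comp (by fun_prop)
    have := (hc.tendsto 0).mono_left (nhdsWithin_le_nhds (s := Set.Ioi 0))
    simpa using this
  rw [one_mul] at hlim
  refine ge_of_tendsto hlim ?_
  filter_upwards [self_mem_nhdsWithin] with ε hε
  have hε : 0 < ε := hε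
  calc _ ≤ ∫⁻ x, ENNReal.ofReal (Real.exp (-(2 * lam * ε))) * (smoothWeight x₀ lam ε x *
        (∫⁻ y, G (x + y) ∂(heatMeasure E τ)) ^ 2) := by
        refine lintegral_mono fun x => ?_
        rw [← mul_assoc, smoothWeight, ← ENNReal.ofReal_mul (by positivity), ← Real.exp_add]
        gcongr
        have h : √(‖x - x₀‖ ^ 2 + ε ^ 2) ≤ ‖x - x₀‖ + ε :=
          Real.sqrt_le_iff.mpr ⟨by positivity, by nlinarith [norm_nonneg (x - x₀)]⟩
        nlinarith
    _ = ENNReal.ofReal (Real.exp (-(2 * lam * ε))) * ∫⁻ x, smoothWeight x₀ lam ε x *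
        (∫⁻ y, G (x + y) ∂(heatMeasure E τ)) ^ 2 :=
        lintegral_const_mul' _ _ ENNReal.ofReal_ne_top
    _ ≤ _ := by
        refine mul_le_mul_right ((lintegral_smoothWeight_heatMeasure_le x₀ lam hε hτ hG).trans ?_) _
        refine mul_le_mul_right (lintegral_mono fun x => mul_le_mul_left ?_ _) _
        refine ENNReal.ofReal_le_ofReal (Real.exp_le_exp.mpr ?_)
        have h : ‖x - x₀‖ ≤ √(‖x - x₀‖ ^ 2 + ε ^ 2) := Real.le_sqrt_of_sq_le (by nlinarith)
        nlinarith

end HeatMeasure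

/-- Davies' exponentially weighted L² estimate (inequality (2.13) of the
paper, static flat case): with `u(x) = ∫ (4πτ)^{-n/2} e^{-‖x−y‖²/(4τ)}
e^{-λ‖y−x₀‖} f(y) dy` and `λ ≤ 0`, one has
`∫ e^{2λ‖x−x₀‖} u(x)² dx ≤ e^{2λ²τ} ∫ f²`. -/
theorem davies_weighted_L2_estimate
    (n : ℕ) (hn : 1 ≤ n) (x₀ : EuclideanSpace ℝ (Fin n)) (lam τ : ℝ)
    (hlam : lam ≤ 0) (hτ : 0 < τ)
    (f : EuclideanSpace ℝ (Fin n) → ℝ)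
    (hf : Continuous f) (hsupp : HasCompactSupport f)
    (u : EuclideanSpace ℝ (Fin n) → ℝ)
    (hu : ∀ x, u x =
      ∫ y, (4 * Real.pi * τ) ^ (-(n : ℝ) / 2)
        * Real.exp (-‖x - y‖ ^ 2 / (4 * τ))
        * Real.exp (-lam * ‖y - x₀‖) * f y) :
    ∫ x, Real.exp (2 * lam * ‖x - x₀‖) * u x ^ 2
      ≤ Real.exp (2 * lam ^ 2 * τ) * ∫ y, f y ^ 2 := by
  set g : EuclideanSpace ℝ (Fin n) → ℝ := fun y => Real.exp (-lam * ‖y - x₀‖) * f y with hg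
  have hgc : Continuous g := by fun_prop
  have hue : ∀ x, ‖u x‖ₑ ≤ ∫⁻ y, ‖g (x + y)‖ₑ ∂(heatMeasure (EuclideanSpace ℝ (Fin n)) τ) := by
    intro x
    have h : u x = ∫ y, g (x + y) ∂(heatMeasure (EuclideanSpace ℝ (Fin n)) τ) := by
      rw [heatMeasure_eq_withDensity hτ,
        integral_withDensity_eq_integral_toReal_smul (by fun_prop) (by simp), hu x,
        ← integral_add_left_eq_self _ x]
      refine integral_congr_ae (ae_of_all _ fun y => ?_)
      have hpi := Real.pi_pos
      simp only [hg, finrank_euclideanSpace_fin, smul_eq_mul, sub_add_cancel_left, norm_neg]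
      rw [ENNReal.toReal_ofReal (by positivity)]
      ring
    rw [h]
    exact enorm_integral_le_lintegral_enorm _
  have hf2 : Integrable fun y => f y ^ 2 :=
    (hf.pow 2).integrable_of_hasCompactSupport
      (hsupp.mono fun y hy => by simpa using hy)
  by_cases hint : Integrable fun x => Real.exp (2 * lam * ‖x - x₀‖) * u x ^ 2
  swap
  · rw [integral_undef hint]
    exact mul_nonneg (Real.exp_pos _).le (integral_nonneg fun y => sq_nonneg _)
  have hsq : ∀ r : ℝ, ENNReal.ofReal (r ^ 2) = ‖r‖ₑ ^ 2 := fun r => by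
    rw [← enorm_pow, Real.enorm_of_nonneg (sq_nonneg r)]
  rw [← ENNReal.ofReal_le_ofReal_iff
      (mul_nonneg (Real.exp_pos _).le (integral_nonneg fun y => sq_nonneg _)),
    ENNReal.ofReal_mul (Real.exp_pos _).le,
    ofReal_integral_eq_lintegral_ofReal hint (ae_of_all _ fun x => by positivity),
    ofReal_integral_eq_lintegral_ofReal hf2 (ae_of_all _ fun y => sq_nonneg _)]
  calc _ ≤ ∫⁻ x, ENNReal.ofReal (Real.exp (2 * lam * ‖x - x₀‖)) *
        (∫⁻ y, ‖g (x + y)‖ₑ ∂(heatMeasure (EuclideanSpace ℝ (Fin n)) τ)) ^ 2 := by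
        refine lintegral_mono fun x => ?_
        rw [ENNReal.ofReal_mul (Real.exp_pos _).le, hsq]
        gcongr
        exact hue x
    _ ≤ _ := lintegral_exp_mul_sq_heatMeasure_le x₀ hlam hτ (G := fun y => ‖g y‖ₑ) (by fun_prop)
    _ = _ := by
        congr 1
        refine lintegral_congr fun y => ?_
        rw [← hsq, ← ENNReal.ofReal_mul (Real.exp_pos _).le]
        congr 1
        simp only [hg]
        rw [mul_pow, ← mul_assoc, ← Real.exp_nat_mul, ← Real.exp_add]
        simp
        ring_nf
        simp
end
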